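/- arXiv:1807.10341 — 8 statements merged into one kernel-verified Lean document; each statement's English description precedes it below -/
import Mathlib

section
/- Let γ > 0 and α ∈ ℝ. Define the Burgers vortex velocity V^{rB}(x) = (γ/2)(−x₁, −x₂, 2x₃) + (α(1 − e^{−γ|x'|²/4})/(2π|x'|²))(−x₂, x₁, 0), and the pressure P^{rB}(x) = −(1/2)|V^{rB}(x)|² − (α²γ/(16π²)) ∫_{γ|x'|²}^{∞} (1/r)(1 − e^{−r/4}) e^{−r/4} dr, where x' = (x₁,x₂). Then for every x ∈ ℝ³ with x' ≠ 0, the pair (V^{rB}, P^{rB}) is a steady solution of the Navier–Stokes equations: −ΔV^{rB}(x) + ∇P^{rB}(x) + (V^{rB}·∇)V^{rB}(x) = 0 and ∇·V^{rB}(x) = 0. -/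
open MeasureTheory

noncomputable section

/-- Partial derivative in the `i`-th coordinate direction of a scalar function on `ℝ³`. -/
def pd (i : Fin 3) (f : (Fin 3 → ℝ) → ℝ) (x : Fin 3 → ℝ) : ℝ :=
  fderiv ℝ f x (Pi.single i 1)

/-- The Burgers vortex velocity field. -/
def VrB (γ α : ℝ) (x : Fin 3 → ℝ) : Fin 3 → ℝ :=
  (γ / 2) • ![-(x 0), -(x 1), 2 * x 2] +
    (α * (1 - Real.exp (-(γ * (x 0 ^ 2 + x 1 ^ 2)) / 4)) /
        (2 * Real.pi * (x 0 ^ 2 + x 1 ^ 2))) • ![-(x 1), x 0, 0]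

/-- The Burgers vortex pressure. -/
def PrB (γ α : ℝ) (x : Fin 3 → ℝ) : ℝ :=
  -(1 / 2) * (∑ i, (VrB γ α x i) ^ 2) -
    (α ^ 2 * γ / (16 * Real.pi ^ 2)) *
      ∫ r in Set.Ioi (γ * (x 0 ^ 2 + x 1 ^ 2)),
        (1 / r) * (1 - Real.exp (-r / 4)) * Real.exp (-r / 4)

/-- The scalar function `f` on `ℝ³` has gradient `(a, b, c)` at `x`. -/
def HasGrad (f : (Fin 3 → ℝ) → ℝ) (a b c : ℝ) (x : Fin 3 → ℝ) : Prop :=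
  HasFDerivAt f (a • ContinuousLinearMap.proj (R := ℝ) (φ := fun _ : Fin 3 => ℝ) 0 +
    b • ContinuousLinearMap.proj (R := ℝ) (φ := fun _ : Fin 3 => ℝ) 1 +
    c • ContinuousLinearMap.proj (R := ℝ) (φ := fun _ : Fin 3 => ℝ) 2) x

namespace HasGrad

variable {f g : (Fin 3 → ℝ) → ℝ} {a b c a' b' c' : ℝ} {x : Fin 3 → ℝ}

lemma pd_eq (h : HasGrad f a b c x) (i : Fin 3) : pd i f x = ![a, b, c] i := by
  rw [pd, HasFDerivAt.fderiv h]
  fin_cases i <;> simp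

lemma congr_grad (h : HasGrad f a b c x) (ha : a = a') (hb : b = b') (hc : c = c') :
    HasGrad f a' b' c' x := by
  subst ha hb hc
  exact h

lemma congr_of_eventuallyEq (h : HasGrad f a b c x) (hfg : g =ᶠ[nhds x] f) :
    HasGrad g a b c x :=
  HasFDerivAt.congr_of_eventuallyEq h hfg

lemma const (k : ℝ) : HasGrad (fun _ => k) 0 0 0 x := by
  simpa [HasGrad] using hasFDerivAt_const k x

lemma coord_zero : HasGrad (fun y => y 0) 1 0 0 x := by
  simpa [HasGrad] using hasFDerivAt_apply (𝕜 := ℝ) (F' := fun _ : Fin 3 => ℝ) 0 x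

lemma coord_one : HasGrad (fun y => y 1) 0 1 0 x := by
  simpa [HasGrad] using hasFDerivAt_apply (𝕜 := ℝ) (F' := fun _ : Fin 3 => ℝ) 1 x

lemma coord_two : HasGrad (fun y => y 2) 0 0 1 x := by
  simpa [HasGrad] using hasFDerivAt_apply (𝕜 := ℝ) (F' := fun _ : Fin 3 => ℝ) 2 x

lemma add (hf : HasGrad f a b c x) (hg : HasGrad g a' b' c' x) :
    HasGrad (fun y => f y + g y) (a + a') (b + b') (c + c') x := by
  refine (HasFDerivAt.add hf hg).congr_fderiv ?_
  ext v
  simp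
  ring

lemma mul (hf : HasGrad f a b c x) (hg : HasGrad g a' b' c' x) :
    HasGrad (fun y => f y * g y) (f x * a' + g x * a) (f x * b' + g x * b)
      (f x * c' + g x * c) x := by
  refine (HasFDerivAt.mul hf hg).congr_fderiv ?_
  ext v
  simp
  ring

lemma comp {φ : ℝ → ℝ} {φ' : ℝ} (hφ : HasDerivAt φ φ' (f x)) (hf : HasGrad f a b c x) :
    HasGrad (fun y => φ (f y)) (φ' * a) (φ' * b) (φ' * c) x := by
  refine (hφ.comp_hasFDerivAt x hf).congr_fderiv ?_
  ext v
  simp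
  ring

lemma radial {φ : ℝ → ℝ} {φ' : ℝ} (hφ : HasDerivAt φ φ' (x 0 ^ 2 + x 1 ^ 2)) :
    HasGrad (fun y => φ (y 0 ^ 2 + y 1 ^ 2)) (φ' * (2 * x 0)) (φ' * (2 * x 1)) 0 x := by
  have h : HasGrad (fun y : Fin 3 → ℝ => y 0 ^ 2 + y 1 ^ 2) (2 * x 0) (2 * x 1) 0 x := by
    simp only [pow_two]
    exact ((coord_zero.mul coord_zero).add (coord_one.mul coord_one)).congr_grad
      (by ring) (by ring) (by ring)
  exact (comp hφ h).congr_grad rfl rfl (by ring)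

end HasGrad

/-- Angular velocity of the Burgers vortex as a function of `s = |x'|²`. -/
def angularVelocity (γ α s : ℝ) : ℝ :=
  α * (1 - Real.exp (-(γ * s) / 4)) / (2 * Real.pi * s)

/-- Half of the axial vorticity of the Burgers vortex as a function of `s = |x'|²`. -/
def halfVorticity (γ α s : ℝ) : ℝ :=
  α * γ / (8 * Real.pi) * Real.exp (-(γ * s) / 4)

/-- The derivative of `angularVelocity γ α`. -/
def angularVelocityDeriv (γ α s : ℝ) : ℝ :=
  (halfVorticity γ α s - angularVelocity γ α s) / s

lemma hasDerivAt_exp_neg_mul_div_four (γ s : ℝ) :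
    HasDerivAt (fun t => Real.exp (-(γ * t) / 4)) (-(γ / 4) * Real.exp (-(γ * s) / 4)) s := by
  have h : HasDerivAt (fun t => -(γ * t) / 4) (-(γ * 1) / 4) s :=
    ((hasDerivAt_id s).const_mul γ).fun_neg.div_const 4
  exact h.exp.congr_deriv (by ring)

lemma hasDerivAt_angularVelocity (γ α : ℝ) {s : ℝ} (hs : s ≠ 0) :
    HasDerivAt (angularVelocity γ α) (angularVelocityDeriv γ α s) s := by
  have h2 : 2 * Real.pi * s ≠ 0 := by positivity
  refine ((((hasDerivAt_exp_neg_mul_div_four γ s).const_sub 1).const_mul α).div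
    ((hasDerivAt_id s).const_mul (2 * Real.pi)) h2).congr_deriv ?_
  simp only [angularVelocityDeriv, halfVorticity, angularVelocity, id]
  field_simp
  ring

lemma hasDerivAt_halfVorticity (γ α s : ℝ) :
    HasDerivAt (halfVorticity γ α) (-(γ / 4) * halfVorticity γ α s) s := by
  refine ((hasDerivAt_exp_neg_mul_div_four γ s).const_mul (α * γ / (8 * Real.pi))).congr_deriv ?_
  simp only [halfVorticity]
  ring

lemma hasDerivAt_angularVelocityDeriv (γ α : ℝ) {s : ℝ} (hs : s ≠ 0) :
    HasDerivAt (angularVelocityDeriv γ α)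
      ((-(γ / 4) * halfVorticity γ α s - 2 * angularVelocityDeriv γ α s) / s) s := by
  refine (((hasDerivAt_halfVorticity γ α s).sub (hasDerivAt_angularVelocity γ α hs)).div
    (hasDerivAt_id s) hs).congr_deriv ?_
  simp only [angularVelocityDeriv, id, Pi.sub_apply]
  field_simp
  ring

lemma HasDerivAt.integral_Ioi {k : ℝ → ℝ} {a t : ℝ} (hat : a < t)
    (hk : IntegrableOn k (Set.Ioi a)) (hc : ContinuousAt k t) :
    HasDerivAt (fun u => ∫ r in Set.Ioi u, k r) (-k t) t := by
  have hii : ∀ u, a < u → IntervalIntegrable k volume a u := fun u hu =>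
    (intervalIntegrable_iff_integrableOn_Ioc_of_le hu.le).2
      (hk.mono_set Set.Ioc_subset_Ioi_self)
  have hm : StronglyMeasurableAtFilter k (nhds t) :=
    ⟨Set.Ioi a, Ioi_mem_nhds hat, hk.aestronglyMeasurable⟩
  have h := (intervalIntegral.integral_hasDerivAt_right (hii t hat) hm hc).const_sub
    (∫ r in Set.Ioi a, k r)
  refine h.congr_of_eventuallyEq ?_
  filter_upwards [Ioi_mem_nhds hat] with u hu
  rw [← intervalIntegral.integral_interval_add_Ioi hk (hk.mono_set (Set.Ioi_subset_Ioi hu.le))]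
  ring

lemma integrableOn_burgers_kernel {a : ℝ} (ha : 0 < a) :
    IntegrableOn (fun r : ℝ => 1 / r * (1 - Real.exp (-r / 4)) * Real.exp (-r / 4))
      (Set.Ioi a) := by
  have hexp : IntegrableOn (fun r : ℝ => 1 / a * Real.exp (-(1 / 4) * r)) (Set.Ioi a) :=
    (exp_neg_integrableOn_Ioi a (by norm_num)).const_mul _
  refine hexp.mono' (by fun_prop) ?_
  refine (ae_restrict_iff' measurableSet_Ioi).2 (.of_forall fun r hr => ?_)
  have hr : a < r := hr
  have hr0 : 0 < r := ha.trans hr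
  have h1 : Real.exp (-r / 4) ≤ 1 := Real.exp_le_one_iff.2 (by linarith)
  have h2 := Real.exp_pos (-r / 4)
  rw [show -(1 / 4) * r = -r / 4 by ring, Real.norm_of_nonneg
    (mul_nonneg (mul_nonneg (by positivity) (by linarith)) h2.le)]
  refine mul_le_mul_of_nonneg_right ?_ h2.le
  calc 1 / r * (1 - Real.exp (-r / 4)) ≤ 1 / r * 1 := by gcongr; linarith
    _ ≤ 1 / a := by rw [mul_one]; gcongr

lemma hasDerivAt_burgers_integral {t : ℝ} (ht : 0 < t) :
    HasDerivAt (fun u => ∫ r in Set.Ioi u,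
        1 / r * (1 - Real.exp (-r / 4)) * Real.exp (-r / 4))
      (-(1 / t * (1 - Real.exp (-t / 4)) * Real.exp (-t / 4))) t := by
  refine HasDerivAt.integral_Ioi (half_lt_self ht)
    (integrableOn_burgers_kernel (half_pos ht)) ?_
  have := ht.ne'
  fun_prop (disch := assumption)

lemma VrB_zero (γ α : ℝ) : (fun z => VrB γ α z 0) =
    fun z => -(γ / 2) * z 0 + -1 * (angularVelocity γ α (z 0 ^ 2 + z 1 ^ 2) * z 1) := by
  ext z
  simp [VrB, angularVelocity]

lemma VrB_one (γ α : ℝ) : (fun z => VrB γ α z 1) =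
    fun z => -(γ / 2) * z 1 + angularVelocity γ α (z 0 ^ 2 + z 1 ^ 2) * z 0 := by
  ext z
  simp [VrB, angularVelocity]

lemma VrB_two (γ α : ℝ) : (fun z => VrB γ α z 2) = fun z => γ * z 2 := by
  ext z
  simp [VrB]
  ring

section Gradients

variable (γ α : ℝ) {x : Fin 3 → ℝ}

lemma hasGrad_VrB_zero (hs : x 0 ^ 2 + x 1 ^ 2 ≠ 0) :
    HasGrad (fun z => VrB γ α z 0)
      (-(γ / 2) + -2 * (angularVelocityDeriv γ α (x 0 ^ 2 + x 1 ^ 2) * (x 0 * x 1)))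
      (-1 * angularVelocity γ α (x 0 ^ 2 + x 1 ^ 2) +
        -2 * (angularVelocityDeriv γ α (x 0 ^ 2 + x 1 ^ 2) * (x 1 * x 1))) 0 x := by
  rw [VrB_zero]
  exact (((HasGrad.const _).mul .coord_zero).add ((HasGrad.const _).mul
    ((HasGrad.radial (hasDerivAt_angularVelocity γ α hs)).mul .coord_one))).congr_grad
    (by ring) (by ring) (by ring)

lemma hasGrad_VrB_one (hs : x 0 ^ 2 + x 1 ^ 2 ≠ 0) :
    HasGrad (fun z => VrB γ α z 1)
      (angularVelocity γ α (x 0 ^ 2 + x 1 ^ 2) +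
        2 * (angularVelocityDeriv γ α (x 0 ^ 2 + x 1 ^ 2) * (x 0 * x 0)))
      (-(γ / 2) + 2 * (angularVelocityDeriv γ α (x 0 ^ 2 + x 1 ^ 2) * (x 0 * x 1))) 0 x := by
  rw [VrB_one]
  exact (((HasGrad.const _).mul .coord_one).add
    ((HasGrad.radial (hasDerivAt_angularVelocity γ α hs)).mul .coord_zero)).congr_grad
    (by ring) (by ring) (by ring)

lemma hasGrad_VrB_two : HasGrad (fun z => VrB γ α z 2) 0 0 γ x := by
  rw [VrB_two]
  exact ((HasGrad.const _).mul .coord_two).congr_grad (by ring) (by ring) (by ring)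

lemma eventually_radius_ne_zero (hs : x 0 ^ 2 + x 1 ^ 2 ≠ 0) :
    ∀ᶠ y : Fin 3 → ℝ in nhds x, y 0 ^ 2 + y 1 ^ 2 ≠ 0 :=
  ContinuousAt.eventually_ne (by fun_prop) hs

lemma laplacian_VrB_zero (hs : x 0 ^ 2 + x 1 ^ 2 ≠ 0) :
    ∑ j, pd j (fun y => pd j (fun z => VrB γ α z 0) y) x =
      γ * x 1 * halfVorticity γ α (x 0 ^ 2 + x 1 ^ 2) := by
  have hev := eventually_radius_ne_zero hs
  have hG := HasGrad.radial (hasDerivAt_angularVelocity γ α hs)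
  have hG' := HasGrad.radial (hasDerivAt_angularVelocityDeriv γ α hs)
  have h0 := (((HasGrad.const (-(γ / 2))).add ((HasGrad.const (-2)).mul (hG'.mul
    (HasGrad.coord_zero.mul .coord_one)))).congr_of_eventuallyEq
      (hev.mono fun y hy => (hasGrad_VrB_zero γ α hy).pd_eq 0)).pd_eq 0
  have h1 := ((((HasGrad.const (-1)).mul hG).add ((HasGrad.const (-2)).mul (hG'.mul
    (HasGrad.coord_one.mul .coord_one)))).congr_of_eventuallyEq
      (hev.mono fun y hy => (hasGrad_VrB_zero γ α hy).pd_eq 1)).pd_eq 1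
  have h2 := ((HasGrad.const 0).congr_of_eventuallyEq
      (hev.mono fun y hy => (hasGrad_VrB_zero γ α hy).pd_eq 2)).pd_eq 2
  rw [Fin.sum_univ_three, h0, h1, h2]
  simp
  field_simp
  ring

lemma laplacian_VrB_one (hs : x 0 ^ 2 + x 1 ^ 2 ≠ 0) :
    ∑ j, pd j (fun y => pd j (fun z => VrB γ α z 1) y) x =
      -(γ * x 0 * halfVorticity γ α (x 0 ^ 2 + x 1 ^ 2)) := by
  have hev := eventually_radius_ne_zero hs
  have hG := HasGrad.radial (hasDerivAt_angularVelocity γ α hs)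
  have hG' := HasGrad.radial (hasDerivAt_angularVelocityDeriv γ α hs)
  have h0 := ((hG.add ((HasGrad.const 2).mul (hG'.mul
    (HasGrad.coord_zero.mul .coord_zero)))).congr_of_eventuallyEq
      (hev.mono fun y hy => (hasGrad_VrB_one γ α hy).pd_eq 0)).pd_eq 0
  have h1 := (((HasGrad.const (-(γ / 2))).add ((HasGrad.const 2).mul (hG'.mul
    (HasGrad.coord_zero.mul .coord_one)))).congr_of_eventuallyEq
      (hev.mono fun y hy => (hasGrad_VrB_one γ α hy).pd_eq 1)).pd_eq 1
  have h2 := ((HasGrad.const 0).congr_of_eventuallyEq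
      (hev.mono fun y hy => (hasGrad_VrB_one γ α hy).pd_eq 2)).pd_eq 2
  rw [Fin.sum_univ_three, h0, h1, h2]
  simp
  field_simp
  ring

lemma laplacian_VrB_two :
    ∑ j, pd j (fun y => pd j (fun z => VrB γ α z 2) y) x = 0 := by
  have h (j : Fin 3) := (HasGrad.const (x := x) (![0, 0, γ] j)).congr_of_eventuallyEq
      (.of_forall fun y => (hasGrad_VrB_two γ α (x := y)).pd_eq j) |>.pd_eq j
  simp only [h]
  simp [Fin.sum_univ_three]

lemma hasGrad_PrB (hγ : 0 < γ) (hs : 0 < x 0 ^ 2 + x 1 ^ 2) :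
    HasGrad (PrB γ α)
      (-(VrB γ α x 0 * pd 0 (fun z => VrB γ α z 0) x +
          VrB γ α x 1 * pd 0 (fun z => VrB γ α z 1) x) +
        2 * x 0 * angularVelocity γ α (x 0 ^ 2 + x 1 ^ 2) *
          halfVorticity γ α (x 0 ^ 2 + x 1 ^ 2))
      (-(VrB γ α x 0 * pd 1 (fun z => VrB γ α z 0) x +
          VrB γ α x 1 * pd 1 (fun z => VrB γ α z 1) x) +
        2 * x 1 * angularVelocity γ α (x 0 ^ 2 + x 1 ^ 2) *
          halfVorticity γ α (x 0 ^ 2 + x 1 ^ 2))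
      (-(γ * VrB γ α x 2)) x := by
  have hV0 := hasGrad_VrB_zero γ α hs.ne'
  have hV1 := hasGrad_VrB_one γ α hs.ne'
  have hV2 := hasGrad_VrB_two γ α (x := x)
  have hI := HasGrad.radial (x := x) <|
    (hasDerivAt_burgers_integral (mul_pos hγ hs)).comp (x 0 ^ 2 + x 1 ^ 2)
      ((hasDerivAt_id (x 0 ^ 2 + x 1 ^ 2)).const_mul γ)
  have h := ((HasGrad.const (-(1 / 2))).mul
    (((hV0.mul hV0).add (hV1.mul hV1)).add (hV2.mul hV2))).add
    ((HasGrad.const (-(α ^ 2 * γ / (16 * Real.pi ^ 2)))).mul hI)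
  have hP : PrB γ α = fun y => -(1 / 2) * (VrB γ α y 0 * VrB γ α y 0 +
      VrB γ α y 1 * VrB γ α y 1 + VrB γ α y 2 * VrB γ α y 2) +
      -(α ^ 2 * γ / (16 * Real.pi ^ 2)) * ∫ r in Set.Ioi (γ * (y 0 ^ 2 + y 1 ^ 2)),
        (1 / r) * (1 - Real.exp (-r / 4)) * Real.exp (-r / 4) := by
    ext y
    simp only [PrB, Fin.sum_univ_three]
    ring
  have hk : α ^ 2 * γ / (16 * Real.pi ^ 2) * (1 / (γ * (x 0 ^ 2 + x 1 ^ 2)) *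
      (1 - Real.exp (-(γ * (x 0 ^ 2 + x 1 ^ 2)) / 4)) *
      Real.exp (-(γ * (x 0 ^ 2 + x 1 ^ 2)) / 4)) * γ =
      angularVelocity γ α (x 0 ^ 2 + x 1 ^ 2) * halfVorticity γ α (x 0 ^ 2 + x 1 ^ 2) := by
    simp only [angularVelocity, halfVorticity]
    field_simp
    ring
  rw [hP]
  refine h.congr_grad ?_ ?_ (by ring)
  · rw [hV0.pd_eq, hV1.pd_eq]
    simp only [Matrix.cons_val]
    linear_combination 2 * x 0 * hk
  · rw [hV0.pd_eq, hV1.pd_eq]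
    simp only [Matrix.cons_val]
    linear_combination 2 * x 1 * hk

end Gradients

/-- The Burgers vortex is a steady solution of the Navier–Stokes equations:
`-ΔV + ∇P + (V·∇)V = 0` and `∇·V = 0` at every point with `x' ≠ 0`. -/
theorem burgers_vortex_is_steady_solution
    (γ α : ℝ) (hγ : 0 < γ) (x : Fin 3 → ℝ) (hx : ¬(x 0 = 0 ∧ x 1 = 0)) :
    (∀ i : Fin 3,
        -(∑ j, pd j (fun y => pd j (fun z => VrB γ α z i) y) x) +
            pd i (PrB γ α) x +
            ∑ j, VrB γ α x j * pd j (fun z => VrB γ α z i) x = 0) ∧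
      (∑ i, pd i (fun z => VrB γ α z i) x = 0) := by
  have hs : 0 < x 0 ^ 2 + x 1 ^ 2 := by
    by_contra! h
    exact hx ⟨by nlinarith [sq_nonneg (x 0), sq_nonneg (x 1)],
      by nlinarith [sq_nonneg (x 0), sq_nonneg (x 1)]⟩
  have hV0 := hasGrad_VrB_zero γ α hs.ne'
  have hV1 := hasGrad_VrB_one γ α hs.ne'
  have hV2 := hasGrad_VrB_two γ α (x := x)
  have hP := hasGrad_PrB γ α hγ hs
  have hv0 := congrFun (VrB_zero γ α) x
  have hv1 := congrFun (VrB_one γ α) x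
  have hW : (x 0 ^ 2 + x 1 ^ 2) * angularVelocityDeriv γ α (x 0 ^ 2 + x 1 ^ 2) =
      halfVorticity γ α (x 0 ^ 2 + x 1 ^ 2) - angularVelocity γ α (x 0 ^ 2 + x 1 ^ 2) :=
    mul_div_cancel₀ _ hs.ne'
  refine ⟨Fin.forall_fin_succ.2 ⟨?_, Fin.forall_fin_two.2 ⟨?_, ?_⟩⟩, ?_⟩
  · rw [laplacian_VrB_zero γ α hs.ne', hP.pd_eq, Fin.sum_univ_three]
    simp only [hV0.pd_eq, hV1.pd_eq, Matrix.cons_val]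
    linear_combination -2 * VrB γ α x 1 * hW -
      2 * halfVorticity γ α (x 0 ^ 2 + x 1 ^ 2) * hv1
  · change -(∑ j, pd j (fun y => pd j (fun z => VrB γ α z 1) y) x) + pd 1 (PrB γ α) x +
      ∑ j, VrB γ α x j * pd j (fun z => VrB γ α z 1) x = 0
    rw [laplacian_VrB_one γ α hs.ne', hP.pd_eq, Fin.sum_univ_three]
    simp only [hV0.pd_eq, hV1.pd_eq, Matrix.cons_val]
    linear_combination 2 * VrB γ α x 0 * hW +
      2 * halfVorticity γ α (x 0 ^ 2 + x 1 ^ 2) * hv0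
  · change -(∑ j, pd j (fun y => pd j (fun z => VrB γ α z 2) y) x) + pd 2 (PrB γ α) x +
      ∑ j, VrB γ α x j * pd j (fun z => VrB γ α z 2) x = 0
    rw [laplacian_VrB_two, hP.pd_eq, Fin.sum_univ_three]
    simp only [hV2.pd_eq, Matrix.cons_val]
    ring
  · rw [Fin.sum_univ_three, hV0.pd_eq, hV1.pd_eq, hV2.pd_eq]
    simp only [Matrix.cons_val]
    ring

end
end

section
/- Let γ > 0 and α ∈ ℝ, and let V^{rB}(x) = (γ/2)(−x₁, −x₂, 2x₃) + (α(1 − e^{−γ|x'|²/4})/(2π|x'|²))(−x₂, x₁, 0) with x' = (x₁,x₂). Then for every x ∈ ℝ³ with x' ≠ 0, the vorticity of the Burgers vortex is (∇ × V^{rB})(x) = (0, 0, α γ g(√γ x')), where g(ξ') = (1/(4π)) e^{−|ξ'|²/4}. -/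
open MeasureTheory

noncomputable section

/-- The Gaussian vorticity profile `g(ξ') = (1/(4π)) e^{-|ξ'|²/4}` on `ℝ²`. -/
def g2 (ξ : Fin 2 → ℝ) : ℝ := (1 / (4 * Real.pi)) * Real.exp (-(ξ 0 ^ 2 + ξ 1 ^ 2) / 4)

/-- The curl `∇ × V` of a vector field on `ℝ³`. -/
def curl (V : (Fin 3 → ℝ) → Fin 3 → ℝ) (x : Fin 3 → ℝ) : Fin 3 → ℝ :=
  ![pd 1 (fun z => V z 2) x - pd 2 (fun z => V z 1) x,
    pd 2 (fun z => V z 0) x - pd 0 (fun z => V z 2) x,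
    pd 0 (fun z => V z 1) x - pd 1 (fun z => V z 0) x]

/-- A horizontally radial function `z ↦ f (z₁² + z₂²)` is differentiable wherever `f` is, with the
derivative given by the chain rule. -/
lemma hasFDerivAt_comp_horizontal_sq {f : ℝ → ℝ} {f' : ℝ} {x : Fin 3 → ℝ}
    (hf : HasDerivAt f f' (x 0 ^ 2 + x 1 ^ 2)) :
    HasFDerivAt (fun z : Fin 3 → ℝ => f (z 0 ^ 2 + z 1 ^ 2))
      (f' • ((2 * x 0) • ContinuousLinearMap.proj (R := ℝ) (φ := fun _ : Fin 3 => ℝ) 0 +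
        (2 * x 1) • ContinuousLinearMap.proj (R := ℝ) (φ := fun _ : Fin 3 => ℝ) 1)) x := by
  have h0 := (hasFDerivAt_apply (𝕜 := ℝ) (F' := fun _ : Fin 3 => ℝ) 0 x).pow 2
  have h1 := (hasFDerivAt_apply (𝕜 := ℝ) (F' := fun _ : Fin 3 => ℝ) 1 x).pow 2
  refine (hf.comp_hasFDerivAt x (h0.add h1)).congr_fderiv ?_
  ext v
  simp

/-- The curl of a linear strain plus a swirl with radial profile `f`. -/
lemma curl_strain_add_swirl (c : ℝ) {f : ℝ → ℝ} {f' : ℝ} {x : Fin 3 → ℝ}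
    (hf : HasDerivAt f f' (x 0 ^ 2 + x 1 ^ 2)) :
    curl (fun z => c • ![-(z 0), -(z 1), 2 * z 2] +
        f (z 0 ^ 2 + z 1 ^ 2) • ![-(z 1), z 0, 0]) x =
      ![0, 0, 2 * (f (x 0 ^ 2 + x 1 ^ 2) + (x 0 ^ 2 + x 1 ^ 2) * f')] := by
  have hF := hasFDerivAt_comp_horizontal_sq hf
  have hc (i : Fin 3) := hasFDerivAt_apply (𝕜 := ℝ) (F' := fun _ : Fin 3 => ℝ) i x
  have d0 := ((hc 0).neg.const_mul c).add (hF.mul (hc 1).neg)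
  have d1 := ((hc 1).neg.const_mul c).add (hF.mul (hc 0))
  have d2 := ((hc 2).const_mul 2).const_mul c
  have e0 : (fun z : Fin 3 → ℝ => (c • ![-(z 0), -(z 1), 2 * z 2] +
      f (z 0 ^ 2 + z 1 ^ 2) • ![-(z 1), z 0, 0]) 0) =
      fun z => c * -(z 0) + f (z 0 ^ 2 + z 1 ^ 2) * -(z 1) := by ext z; simp
  have e1 : (fun z : Fin 3 → ℝ => (c • ![-(z 0), -(z 1), 2 * z 2] +
      f (z 0 ^ 2 + z 1 ^ 2) • ![-(z 1), z 0, 0]) 1) =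
      fun z => c * -(z 1) + f (z 0 ^ 2 + z 1 ^ 2) * z 0 := by ext z; simp
  have e2 : (fun z : Fin 3 → ℝ => (c • ![-(z 0), -(z 1), 2 * z 2] +
      f (z 0 ^ 2 + z 1 ^ 2) • ![-(z 1), z 0, 0]) 2) = fun z => c * (2 * z 2) := by ext z; simp
  have p0 (i : Fin 3) := congrArg (fun L => L (Pi.single i 1)) (HasFDerivAt.fderiv d0)
  have p1 (i : Fin 3) := congrArg (fun L => L (Pi.single i 1)) (HasFDerivAt.fderiv d1)
  have p2 (i : Fin 3) := congrArg (fun L => L (Pi.single i 1)) (HasFDerivAt.fderiv d2)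
  unfold curl pd
  rw [e0, e1, e2]
  ext i
  fin_cases i
  · refine (congrArg₂ (· - ·) (p2 1) (p1 2)).trans ?_
    simp
  · refine (congrArg₂ (· - ·) (p0 2) (p2 0)).trans ?_
    simp
  · refine (congrArg₂ (· - ·) (p1 0) (p0 1)).trans ?_
    simp
    ring

/-- Derivative of the swirl profile of the Burgers vortex as a function of the squared radius. -/
lemma hasDerivAt_burgers_profile (γ α : ℝ) {s : ℝ} (hs : s ≠ 0) :
    HasDerivAt (fun s => α * (1 - Real.exp (-(γ * s) / 4)) / (2 * Real.pi * s))
      ((α * γ / 4 * Real.exp (-(γ * s) / 4) * (2 * Real.pi * s) -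
        α * (1 - Real.exp (-(γ * s) / 4)) * (2 * Real.pi)) / (2 * Real.pi * s) ^ 2) s := by
  have he := ((((((hasDerivAt_id s).const_mul γ).neg).div_const 4).exp).const_sub 1).const_mul α
  have hd := (hasDerivAt_id s).const_mul (2 * Real.pi)
  refine (he.div hd (by simp [hs, Real.pi_ne_zero])).congr_deriv ?_
  simp only [id, Pi.neg_apply]
  ring

/-- The vorticity of the Burgers vortex is `(0, 0, αγ g(√γ x'))`. -/
theorem burgers_vortex_vorticity
    (γ α : ℝ) (hγ : 0 < γ) (x : Fin 3 → ℝ) (hx : ¬(x 0 = 0 ∧ x 1 = 0)) :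
    curl (VrB γ α) x =
      ![0, 0, α * γ * g2 ![Real.sqrt γ * x 0, Real.sqrt γ * x 1]] := by
  have hs : x 0 ^ 2 + x 1 ^ 2 ≠ 0 := fun h => hx
    ⟨by nlinarith [sq_nonneg (x 0), sq_nonneg (x 1)],
      by nlinarith [sq_nonneg (x 0), sq_nonneg (x 1)]⟩
  refine (curl_strain_add_swirl (γ / 2) (hasDerivAt_burgers_profile γ α hs)).trans ?_
  have hg : (√γ * x 0) ^ 2 + (√γ * x 1) ^ 2 = γ * (x 0 ^ 2 + x 1 ^ 2) := by
    rw [mul_pow, mul_pow, Real.sq_sqrt hγ.le]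
    ring
  simp only [g2, Matrix.cons_val_zero, Matrix.cons_val_one, hg]
  have hpi := Real.pi_ne_zero
  congr 3
  field_simp
  ring

end
end

section
/- For every ξ' ∈ ℝ² with ξ' ≠ 0, the vector field U^G satisfies the identity Δ'U^G(ξ') + (ξ'/2)·∇'U^G(ξ') + (1/2) U^G(ξ') = 0, where Δ' = ∂₁² + ∂₂² and ∇' = (∂₁, ∂₂) act componentwise on U^G regarded as a function of ξ' ∈ ℝ² with values in ℝ³. -/
noncomputable section

/-- Partial derivative in the `i`-th coordinate direction of a scalar function on `ℝ²`. -/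
def pd2 (i : Fin 2) (f : (Fin 2 → ℝ) → ℝ) (ξ : Fin 2 → ℝ) : ℝ :=
  fderiv ℝ f ξ (Pi.single i 1)

/-- The Burgers vortex velocity profile `U^G`, viewed with values in `ℝ³`. -/
def UG3 (ξ : Fin 2 → ℝ) : Fin 3 → ℝ :=
  ((1 - Real.exp (-(ξ 0 ^ 2 + ξ 1 ^ 2) / 4)) / (2 * Real.pi * (ξ 0 ^ 2 + ξ 1 ^ 2))) •
    ![-(ξ 1), ξ 0, 0]

open Topology in
theorem pd2_congr_of_eventuallyEq {j : Fin 2} {f g : (Fin 2 → ℝ) → ℝ} {ξ : Fin 2 → ℝ}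
    (h : f =ᶠ[𝓝 ξ] g) : pd2 j f ξ = pd2 j g ξ := by
  simp only [pd2, h.fderiv_eq]

theorem hasFDerivAt_sq_add_sq (ξ : Fin 2 → ℝ) :
    HasFDerivAt (fun η : Fin 2 → ℝ => η 0 ^ 2 + η 1 ^ 2)
      ((2 * ξ 0) • ContinuousLinearMap.proj (R := ℝ) (φ := fun _ : Fin 2 => ℝ) 0 +
        (2 * ξ 1) • ContinuousLinearMap.proj (R := ℝ) (φ := fun _ : Fin 2 => ℝ) 1) ξ := by
  have h0 := (hasFDerivAt_apply (𝕜 := ℝ) (F' := fun _ : Fin 2 => ℝ) 0 ξ).pow 2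
  have h1 := (hasFDerivAt_apply (𝕜 := ℝ) (F' := fun _ : Fin 2 => ℝ) 1 ξ).pow 2
  refine (h0.fun_add h1).congr_fderiv ?_
  simp

theorem hasFDerivAt_comp_sq_add_sq {g : ℝ → ℝ} {g₁ : ℝ} {ξ : Fin 2 → ℝ}
    (hg : HasDerivAt g g₁ (ξ 0 ^ 2 + ξ 1 ^ 2)) :
    HasFDerivAt (fun η : Fin 2 → ℝ => g (η 0 ^ 2 + η 1 ^ 2))
      (g₁ • ((2 * ξ 0) • ContinuousLinearMap.proj (R := ℝ) (φ := fun _ : Fin 2 => ℝ) 0 +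
        (2 * ξ 1) • ContinuousLinearMap.proj (R := ℝ) (φ := fun _ : Fin 2 => ℝ) 1)) ξ :=
  hg.comp_hasFDerivAt ξ (hasFDerivAt_sq_add_sq ξ)

theorem pd2_radial_mul_linear {g : ℝ → ℝ} {g₁ : ℝ} {ξ : Fin 2 → ℝ}
    (hg : HasDerivAt g g₁ (ξ 0 ^ 2 + ξ 1 ^ 2)) (L : (Fin 2 → ℝ) →L[ℝ] ℝ) (j : Fin 2) :
    pd2 j (fun η => g (η 0 ^ 2 + η 1 ^ 2) * L η) ξ =
      g₁ * (2 * ξ j) * L ξ + g (ξ 0 ^ 2 + ξ 1 ^ 2) * L (Pi.single j 1) := by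
  rw [pd2, ((hasFDerivAt_comp_sq_add_sq hg).fun_mul L.hasFDerivAt).fderiv]
  fin_cases j <;> simp <;> ring

open Topology in
theorem pd2_pd2_radial_mul_linear {g g₁ : ℝ → ℝ} {g₂ : ℝ} {ξ : Fin 2 → ℝ}
    (hg : ∀ᶠ s in 𝓝 (ξ 0 ^ 2 + ξ 1 ^ 2), HasDerivAt g (g₁ s) s)
    (hg₁ : HasDerivAt g₁ g₂ (ξ 0 ^ 2 + ξ 1 ^ 2)) (L : (Fin 2 → ℝ) →L[ℝ] ℝ) (j : Fin 2) :
    pd2 j (fun η => pd2 j (fun ζ => g (ζ 0 ^ 2 + ζ 1 ^ 2) * L ζ) η) ξ =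
      g₂ * (2 * ξ j) ^ 2 * L ξ + 2 * g₁ (ξ 0 ^ 2 + ξ 1 ^ 2) * L ξ +
        4 * g₁ (ξ 0 ^ 2 + ξ 1 ^ 2) * ξ j * L (Pi.single j 1) := by
  have hev := (hasFDerivAt_sq_add_sq ξ).continuousAt.eventually hg
  rw [pd2_congr_of_eventuallyEq (hev.mono fun η hη => pd2_radial_mul_linear hη L j), pd2]
  have hj := (hasFDerivAt_apply (𝕜 := ℝ) (F' := fun _ : Fin 2 => ℝ) j ξ).const_mul 2
  rw [((((hasFDerivAt_comp_sq_add_sq hg₁).fun_mul hj).fun_mul L.hasFDerivAt).fun_add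
    ((hasFDerivAt_comp_sq_add_sq hg.self_of_nhds).mul_const (L (Pi.single j 1)))).fderiv]
  fin_cases j <;> simp <;> ring

/-- The radial factor of the velocity profile, as a function of `s = |ξ|²`. -/
def vortexFactor (s : ℝ) : ℝ := (1 - Real.exp (-s / 4)) / (2 * Real.pi * s)

/-- The derivative of `vortexFactor` away from `0`. -/
def vortexFactorDeriv (s : ℝ) : ℝ :=
  (Real.exp (-s / 4) / (8 * Real.pi) - vortexFactor s) / s

theorem hasDerivAt_exp_neg_div_four (s : ℝ) :
    HasDerivAt (fun t : ℝ => Real.exp (-t / 4)) (-Real.exp (-s / 4) / 4) s := by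
  refine ((hasDerivAt_id' s).fun_neg.div_const 4).exp.congr_deriv ?_
  ring

theorem hasDerivAt_vortexFactor {s : ℝ} (hs : s ≠ 0) :
    HasDerivAt vortexFactor (vortexFactorDeriv s) s := by
  have hpi := Real.pi_ne_zero
  refine (((hasDerivAt_exp_neg_div_four s).const_sub 1).fun_div
    ((hasDerivAt_id' s).const_mul (2 * Real.pi)) (by positivity)).congr_deriv ?_
  rw [vortexFactorDeriv, vortexFactor]
  field_simp
  ring

theorem hasDerivAt_vortexFactorDeriv {s : ℝ} (hs : s ≠ 0) :
    HasDerivAt vortexFactorDeriv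
      ((-Real.exp (-s / 4) / (32 * Real.pi) - 2 * vortexFactorDeriv s) / s) s := by
  have hpi := Real.pi_ne_zero
  refine ((((hasDerivAt_exp_neg_div_four s).div_const (8 * Real.pi)).fun_sub
    (hasDerivAt_vortexFactor hs)).fun_div (hasDerivAt_id' s) hs).congr_deriv ?_
  simp only [vortexFactorDeriv]
  field_simp
  ring

theorem radial_mul_linear_selfsimilar_identity {ξ : Fin 2 → ℝ} (hξ : ξ ≠ 0)
    (L : (Fin 2 → ℝ) →L[ℝ] ℝ) :
    (∑ j, pd2 j (fun η => pd2 j (fun ζ => vortexFactor (ζ 0 ^ 2 + ζ 1 ^ 2) * L ζ) η) ξ) +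
      (∑ j, (ξ j / 2) * pd2 j (fun ζ => vortexFactor (ζ 0 ^ 2 + ζ 1 ^ 2) * L ζ) ξ) +
      (1 / 2) * (vortexFactor (ξ 0 ^ 2 + ξ 1 ^ 2) * L ξ) = 0 := by
  have hs : ξ 0 ^ 2 + ξ 1 ^ 2 ≠ 0 := by
    contrapose! hξ
    ext j
    fin_cases j <;> simp <;> nlinarith [sq_nonneg (ξ 0), sq_nonneg (ξ 1)]
  have hL : L ξ = ξ 0 * L (Pi.single 0 1) + ξ 1 * L (Pi.single 1 1) := by
    conv_lhs => rw [pi_eq_sum_univ' ξ]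
    simp
  have hev := (eventually_ne_nhds hs).mono fun s hs => hasDerivAt_vortexFactor hs
  simp only [pd2_pd2_radial_mul_linear hev (hasDerivAt_vortexFactorDeriv hs),
    pd2_radial_mul_linear (hasDerivAt_vortexFactor hs), Fin.sum_univ_two]
  have hpi := Real.pi_ne_zero
  rw [hL]
  simp only [vortexFactorDeriv]
  generalize vortexFactor (ξ 0 ^ 2 + ξ 1 ^ 2) = g
  generalize Real.exp (-(ξ 0 ^ 2 + ξ 1 ^ 2) / 4) = E
  field_simp
  ring

/-- The identity `Δ'U^G + (ξ'/2)·∇'U^G + (1/2)U^G = 0` for all `ξ' ≠ 0`,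
componentwise on the three components of `U^G`. -/
theorem UG_selfsimilar_identity (ξ : Fin 2 → ℝ) (hξ : ξ ≠ 0) (i : Fin 3) :
    (∑ j, pd2 j (fun η => pd2 j (fun ζ => UG3 ζ i) η) ξ) +
      (∑ j, (ξ j / 2) * pd2 j (fun ζ => UG3 ζ i) ξ) +
      (1 / 2) * UG3 ξ i = 0 := by
  have key := radial_mul_linear_selfsimilar_identity hξ
  fin_cases i
  · simpa [UG3, vortexFactor] using key (-ContinuousLinearMap.proj 1)
  · simpa [UG3, vortexFactor] using key (ContinuousLinearMap.proj 0)
  · simpa [UG3, vortexFactor] using key 0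

end
end

section
/- Define Φ(ξ') = −(1/(16π²)) ∫_{|ξ'|²}^{∞} (1/r)(1 − e^{−r/4}) e^{−r/4} dr for ξ' ∈ ℝ², ξ' ≠ 0. Then for every ξ' ≠ 0, the cross product U^G(ξ') × G(ξ') equals the three-dimensional vector (∂₁Φ(ξ'), ∂₂Φ(ξ'), 0); that is, U^G × G is the (horizontal) gradient of the potential Φ. -/
open MeasureTheory

noncomputable section

/-- `G(ξ') = (0, 0, g(ξ'))`. -/
def G3 (ξ : Fin 2 → ℝ) : Fin 3 → ℝ := ![0, 0, g2 ξ]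

/-- The cross product of two vectors in `ℝ³`. -/
def cross3 (a b : Fin 3 → ℝ) : Fin 3 → ℝ :=
  ![a 1 * b 2 - a 2 * b 1, a 2 * b 0 - a 0 * b 2, a 0 * b 1 - a 1 * b 0]

/-- The potential `Φ(ξ') = -(1/(16π²)) ∫_{|ξ'|²}^∞ (1/r)(1-e^{-r/4})e^{-r/4} dr`. -/
def Φpot (ξ : Fin 2 → ℝ) : ℝ :=
  -(1 / (16 * Real.pi ^ 2)) *
    ∫ r in Set.Ioi (ξ 0 ^ 2 + ξ 1 ^ 2),
      (1 / r) * (1 - Real.exp (-r / 4)) * Real.exp (-r / 4)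

/-- The function `x ↦ ∫ r in Ioi x, f r` has derivative `-f b` at `b`. -/
theorem hasDerivAt_integral_Ioi {f : ℝ → ℝ} {a b : ℝ} (hab : a < b)
    (hint : IntegrableOn f (Set.Ioi a)) (hcont : ContinuousOn f (Set.Ioi a)) :
    HasDerivAt (fun x => ∫ r in Set.Ioi x, f r) (-f b) b := by
  have hI : IntervalIntegrable f volume a b :=
    (intervalIntegrable_iff_integrableOn_Ioc_of_le hab.le).2
      (hint.mono_set Set.Ioc_subset_Ioi_self)
  have hb : Set.Ioi a ∈ nhds b := Ioi_mem_nhds hab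
  have hd : HasDerivAt (fun x => ∫ r in a..x, f r) (f b) b :=
    intervalIntegral.integral_hasDerivAt_right hI
      (hcont.stronglyMeasurableAtFilter isOpen_Ioi b hab) (hcont.continuousAt hb)
  refine (hd.const_sub (∫ r in Set.Ioi a, f r)).congr_of_eventuallyEq ?_
  filter_upwards [hb] with x hx
  rw [← intervalIntegral.integral_interval_add_Ioi hint
    (hint.mono_set (Set.Ioi_subset_Ioi (le_of_lt hx)))]
  ring

theorem continuousOn_potential_density {a : ℝ} (ha : 0 < a) :
    ContinuousOn (fun r : ℝ => (1 / r) * (1 - Real.exp (-r / 4)) * Real.exp (-r / 4))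
      (Set.Ioi a) := by
  have h : ∀ r ∈ Set.Ioi a, r ≠ 0 := fun r hr => (ha.trans hr).ne'
  fun_prop (disch := assumption)

theorem integrableOn_potential_density {a : ℝ} (ha : 0 < a) :
    IntegrableOn (fun r : ℝ => (1 / r) * (1 - Real.exp (-r / 4)) * Real.exp (-r / 4))
      (Set.Ioi a) := by
  have hg : IntegrableOn (fun r : ℝ => (1 / a) * Real.exp (-(1 / 4) * r)) (Set.Ioi a) :=
    (exp_neg_integrableOn_Ioi a (by norm_num)).const_mul _
  refine Integrable.mono' hg
    ((continuousOn_potential_density ha).aestronglyMeasurable measurableSet_Ioi) ?_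
  filter_upwards [ae_restrict_mem measurableSet_Ioi] with r hr
  have hr' : a < r := hr
  have hr0 : 0 < r := ha.trans hr'
  have h1 : Real.exp (-r / 4) ≤ 1 := Real.exp_le_one_iff.2 (by linarith)
  have h2 : 0 ≤ 1 - Real.exp (-r / 4) := by linarith
  have h3 : 1 - Real.exp (-r / 4) ≤ 1 := by linarith [Real.exp_pos (-r / 4)]
  rw [show -(1 / 4) * r = -r / 4 by ring, Real.norm_of_nonneg (by positivity)]
  gcongr
  calc (1 / r) * (1 - Real.exp (-r / 4)) ≤ (1 / r) * 1 := by gcongr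
    _ ≤ 1 / a := by rw [mul_one]; gcongr

theorem pd2_Φpot (i : Fin 2) {ξ : Fin 2 → ℝ} (hs : 0 < ξ 0 ^ 2 + ξ 1 ^ 2) :
    pd2 i Φpot ξ = (1 / (8 * Real.pi ^ 2)) * ξ i *
      ((1 / (ξ 0 ^ 2 + ξ 1 ^ 2)) * (1 - Real.exp (-(ξ 0 ^ 2 + ξ 1 ^ 2) / 4)) *
        Real.exp (-(ξ 0 ^ 2 + ξ 1 ^ 2) / 4)) := by
  have hq (j : Fin 2) : HasFDerivAt (fun η : Fin 2 → ℝ => η j ^ 2)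
      ((2 * ξ j) • ContinuousLinearMap.proj (R := ℝ) (φ := fun _ : Fin 2 => ℝ) j) ξ := by
    simpa using (hasFDerivAt_apply (𝕜 := ℝ) j ξ).pow 2
  have hd := hasDerivAt_integral_Ioi (half_lt_self hs)
    (integrableOn_potential_density (half_pos hs)) (continuousOn_potential_density (half_pos hs))
  have hΦ : HasFDerivAt Φpot _ ξ :=
    (hd.comp_hasFDerivAt ξ ((hq 0).add (hq 1))).const_mul (-(1 / (16 * Real.pi ^ 2)))
  rw [pd2, hΦ.fderiv]
  fin_cases i <;> simp <;> ring

/-- `U^G × G` is the horizontal gradient of the potential `Φ`: for every `ξ' ≠ 0`,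
`U^G(ξ') × G(ξ') = (∂₁Φ(ξ'), ∂₂Φ(ξ'), 0)`. -/
theorem UG_cross_G_is_gradient (ξ : Fin 2 → ℝ) (hξ : ξ ≠ 0) :
    cross3 (UG3 ξ) (G3 ξ) = ![pd2 0 Φpot ξ, pd2 1 Φpot ξ, 0] := by
  have hs : 0 < ξ 0 ^ 2 + ξ 1 ^ 2 := by
    by_contra! h
    refine hξ (funext (Fin.forall_fin_two.2 ⟨?_, ?_⟩)) <;>
      exact pow_eq_zero_iff two_ne_zero |>.1 (by nlinarith [sq_nonneg (ξ 0), sq_nonneg (ξ 1)])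
  rw [pd2_Φpot 0 hs, pd2_Φpot 1 hs]
  ext i
  fin_cases i <;> simp [cross3, UG3, G3, g2] <;> field_simp <;> ring

end
end

section
/- Let μ > 1, T* > 0, and take the circulation α = α_μ = 4πμ/(μ−1). Set β_μ(t) = (μ−1)/(T*−t) and V^{sB}(x,t) = (μ/(2(T*−t)))(−x₁, −x₂, 2x₃) + α √(β_μ(t)) U^G(√(β_μ(t)) x'). Then for every 0 ≤ t < T*, the supremum over x ∈ ℝ³ with x' ≠ 0 of |(∇ × V^{sB})(x,t)| equals μ/(T*−t); in other words, the strain rate satisfies μ/(2(T*−t)) = (1/2)·sup_x |(∇ × V^{sB})(x,t)|. -/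
open MeasureTheory

noncomputable section

/-- The axisymmetric strain vector `(-x₁, -x₂, 2x₃)`. -/
def strainVec (x : Fin 3 → ℝ) : Fin 3 → ℝ := ![-(x 0), -(x 1), 2 * x 2]

/-- The time-dependent strain-rate scale `β_μ(t) = (μ-1)/(T*-t)`. -/
def βμ (μ T t : ℝ) : ℝ := (μ - 1) / (T - t)

/-- The singular Burgers vortex velocity field. -/
def VsB (μ α T t : ℝ) (x : Fin 3 → ℝ) : Fin 3 → ℝ :=
  (μ / (2 * (T - t))) • strainVec x +
    (α * Real.sqrt (βμ μ T t)) •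
      UG3 ![Real.sqrt (βμ μ T t) * x 0, Real.sqrt (βμ μ T t) * x 1]

/-- The gradient of the radial factor of the Burgers vortex velocity, rescaled by `s`. -/
theorem hasFDerivAt_burgersProfile (s : ℝ) (hs : s ≠ 0) (x : Fin 3 → ℝ)
    (hx : ¬(x 0 = 0 ∧ x 1 = 0)) :
    ∃ k : ℝ,
      HasFDerivAt (fun z : Fin 3 → ℝ =>
        (1 - Real.exp (-((s * z 0) ^ 2 + (s * z 1) ^ 2) / 4)) /
          (2 * Real.pi * ((s * z 0) ^ 2 + (s * z 1) ^ 2)))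
        (k • (x 0 • ContinuousLinearMap.proj (R := ℝ) (φ := fun _ : Fin 3 => ℝ) 0 +
          x 1 • ContinuousLinearMap.proj (R := ℝ) (φ := fun _ : Fin 3 => ℝ) 1)) x ∧
      2 * ((1 - Real.exp (-((s * x 0) ^ 2 + (s * x 1) ^ 2) / 4)) /
          (2 * Real.pi * ((s * x 0) ^ 2 + (s * x 1) ^ 2))) + k * (x 0 ^ 2 + x 1 ^ 2) =
        Real.exp (-(s ^ 2 * (x 0 ^ 2 + x 1 ^ 2)) / 4) / (4 * Real.pi) := by
  have hρ : x 0 ^ 2 + x 1 ^ 2 ≠ 0 := fun h => hx ⟨by nlinarith [sq_nonneg (x 0), sq_nonneg (x 1)],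
    by nlinarith [sq_nonneg (x 0), sq_nonneg (x 1)]⟩
  have hr : (s * x 0) ^ 2 + (s * x 1) ^ 2 = s ^ 2 * (x 0 ^ 2 + x 1 ^ 2) := by ring
  have hr0 : (s * x 0) ^ 2 + (s * x 1) ^ 2 ≠ 0 := by
    rw [hr]; exact mul_ne_zero (pow_ne_zero 2 hs) hρ
  have hq : HasFDerivAt (fun z : Fin 3 → ℝ => (s * z 0) ^ 2 + (s * z 1) ^ 2)
      ((2 * s ^ 2) • (x 0 • ContinuousLinearMap.proj (R := ℝ) (φ := fun _ : Fin 3 => ℝ) 0 +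
          x 1 • ContinuousLinearMap.proj (R := ℝ) (φ := fun _ : Fin 3 => ℝ) 1)) x := by
    have h0 := ((hasFDerivAt_apply (𝕜 := ℝ) (0 : Fin 3) x).const_mul s).pow 2
    have h1 := ((hasFDerivAt_apply (𝕜 := ℝ) (1 : Fin 3) x).const_mul s).pow 2
    refine (h0.add h1).congr_fderiv ?_
    ext v
    simp
    ring
  have hh : ∀ r : ℝ, r ≠ 0 →
      HasDerivAt (fun r : ℝ => (1 - Real.exp (-r / 4)) / (2 * Real.pi * r))
        ((Real.exp (-r / 4) / 4 * (2 * Real.pi * r) - (1 - Real.exp (-r / 4)) * (2 * Real.pi)) /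
          (2 * Real.pi * r) ^ 2) r := by
    intro r hr
    have h1 := (((hasDerivAt_id r).neg.div_const 4).exp).const_sub 1
    have h2 := (hasDerivAt_id r).const_mul (2 * Real.pi)
    refine (h1.div h2 (by simpa using hr)).congr_deriv ?_
    simp
    ring
  have hcomp := (hh _ hr0).comp_hasFDerivAt x hq
  rw [smul_smul] at hcomp
  refine ⟨_, hcomp, ?_⟩
  rw [hr]
  field_simp
  ring

/-- The vorticity of the singular Burgers vortex away from the axis. -/
theorem curl_VsB (μ α T t : ℝ) (hβ : 0 < βμ μ T t) (x : Fin 3 → ℝ)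
    (hx : ¬(x 0 = 0 ∧ x 1 = 0)) :
    curl (VsB μ α T t) x =
      ![0, 0, α * βμ μ T t * (Real.exp (-(βμ μ T t * (x 0 ^ 2 + x 1 ^ 2)) / 4) /
        (4 * Real.pi))] := by
  have hs2 : Real.sqrt (βμ μ T t) ^ 2 = βμ μ T t := Real.sq_sqrt hβ.le
  have hs0 : Real.sqrt (βμ μ T t) ≠ 0 := (Real.sqrt_pos.2 hβ).ne'
  obtain ⟨k, hg, hk⟩ := hasFDerivAt_burgersProfile _ hs0 x hx
  rw [hs2] at hk
  rw [← hk, ← hs2]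
  have hp := fun i : Fin 3 => hasFDerivAt_apply (𝕜 := ℝ) (F' := fun _ : Fin 3 => ℝ) i x
  have h0 : HasFDerivAt (fun z => VsB μ α T t z 0) _ x :=
    ((hp 0).neg.const_mul (μ / (2 * (T - t)))).add
      ((hg.mul ((hp 1).const_mul (Real.sqrt (βμ μ T t))).neg).const_mul
        (α * Real.sqrt (βμ μ T t)))
  have h1 : HasFDerivAt (fun z => VsB μ α T t z 1) _ x :=
    ((hp 1).neg.const_mul (μ / (2 * (T - t)))).add
      ((hg.mul ((hp 0).const_mul (Real.sqrt (βμ μ T t)))).const_mul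
        (α * Real.sqrt (βμ μ T t)))
  have h2 : HasFDerivAt (fun z => VsB μ α T t z 2) _ x :=
    ((((hp 2).const_mul 2).const_mul (μ / (2 * (T - t)))).add
      ((hg.mul (hasFDerivAt_const 0 x)).const_mul (α * Real.sqrt (βμ μ T t))))
  unfold curl pd
  rw [h0.fderiv, h1.fderiv, h2.fderiv]
  ext i
  fin_cases i
  · simp
  · simp
  · simp
    ring

/-- For the circulation `α = α_μ = 4πμ/(μ-1)`, the supremum over `x` with `x' ≠ 0`
of the Euclidean norm of the vorticity of the singular Burgers vortex equals
`μ/(T*-t)`; equivalently, the strain rate is half the sup-norm of the vorticity. -/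
theorem ohkitani_okamoto_identity
    (μ T : ℝ) (hμ : 1 < μ) (hT : 0 < T)
    (t : ℝ) (ht0 : 0 ≤ t) (htT : t < T) :
    IsLUB
      {r : ℝ | ∃ x : Fin 3 → ℝ, ¬(x 0 = 0 ∧ x 1 = 0) ∧
        r = Real.sqrt (∑ i, (curl (VsB μ (4 * Real.pi * μ / (μ - 1)) T t) x i) ^ 2)}
      (μ / (T - t)) := by
  have hμ1 : 0 < μ - 1 := by linarith
  have hTt : 0 < T - t := by linarith
  have hβ : 0 < βμ μ T t := div_pos hμ1 hTt
  have hM : 0 < μ / (T - t) := div_pos (by linarith) hTt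
  have hnorm : ∀ x : Fin 3 → ℝ, ¬(x 0 = 0 ∧ x 1 = 0) →
      Real.sqrt (∑ i, (curl (VsB μ (4 * Real.pi * μ / (μ - 1)) T t) x i) ^ 2) =
        μ / (T - t) * Real.exp (-(βμ μ T t * (x 0 ^ 2 + x 1 ^ 2)) / 4) := by
    intro x hx
    have hc : 4 * Real.pi * μ / (μ - 1) * βμ μ T t *
        (Real.exp (-(βμ μ T t * (x 0 ^ 2 + x 1 ^ 2)) / 4) / (4 * Real.pi)) =
        μ / (T - t) * Real.exp (-(βμ μ T t * (x 0 ^ 2 + x 1 ^ 2)) / 4) := by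
      generalize Real.exp _ = e
      unfold βμ
      field_simp
    rw [curl_VsB _ _ _ _ hβ x hx, hc, Fin.sum_univ_three]
    simpa using Real.sqrt_sq (mul_pos hM (Real.exp_pos _)).le
  constructor
  · rintro r ⟨x, hx, rfl⟩
    rw [hnorm x hx]
    refine mul_le_of_le_one_right hM.le (Real.exp_le_one_iff.2 ?_)
    have : 0 ≤ βμ μ T t * (x 0 ^ 2 + x 1 ^ 2) := by positivity
    linarith
  · intro b hb
    have hcont : Continuous fun ε : ℝ =>
        μ / (T - t) * Real.exp (-(βμ μ T t * ε ^ 2) / 4) := by fun_prop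
    have hlim := (hcont.tendsto 0).mono_left (nhdsWithin_le_nhds (s := {0}ᶜ))
    have hb' := le_of_tendsto hlim (b := b) (by
      filter_upwards [self_mem_nhdsWithin] with ε hε
      have hx : ¬((![ε, 0, 0] : Fin 3 → ℝ) 0 = 0 ∧ (![ε, 0, 0] : Fin 3 → ℝ) 1 = 0) :=
        fun h => hε h.1
      have := hb ⟨![ε, 0, 0], hx, rfl⟩
      rw [hnorm _ hx] at this
      simpa using this)
    simpa using hb'

end
end

section
/- Let μ > 1, χ = (2μ+1)/(2(μ−1)), a(τ) = 1 − e^{−τ}. For a bounded continuous f: ℝ → ℝ and τ > 0, define (e^{τ𝓛₃}f)(ξ₃) = (χ/(2π a(2χτ)))^{1/2} ∫_ℝ exp(−χ(e^{−χτ} ξ₃ − η₃)²/(2 a(2χτ))) f(η₃) dη₃. Then for every δ > 0, lim_{τ→∞} sup_{|ξ₃| ≤ e^{(χ−δ)τ}} | (e^{τ𝓛₃}f)(ξ₃) − (χ/(2π))^{1/2} ∫_ℝ e^{−χ η₃²/2} f(η₃) dη₃ | = 0. -/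
open MeasureTheory

noncomputable section

/-- `a(τ) = 1 - e^{-τ}`. -/
def aFun (τ : ℝ) : ℝ := 1 - Real.exp (-τ)

/-- `χ = (2μ+1)/(2(μ-1))`. -/
def χμ (μ : ℝ) : ℝ := (2 * μ + 1) / (2 * (μ - 1))

/-- The explicit kernel representation of the semigroup `e^{τ𝓛₃}` generated by
`𝓛₃ f = ∂₃²f - χ ξ₃ ∂₃ f` on `ℝ`. -/
def semigL3 (μ : ℝ) (f : ℝ → ℝ) (ξ τ : ℝ) : ℝ :=
  Real.sqrt (χμ μ / (2 * Real.pi * aFun (2 * χμ μ * τ))) *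
    ∫ η : ℝ,
      Real.exp (-(χμ μ) * (Real.exp (-(χμ μ) * τ) * ξ - η) ^ 2 /
          (2 * aFun (2 * χμ μ * τ))) * f η

lemma continuousAt_gaussian_average {c : ℝ} (hc : 0 < c) {f : ℝ → ℝ} (hf_cont : Continuous f)
    (hf_bdd : ∃ B, ∀ η, |f η| ≤ B) :
    ContinuousAt (fun p : ℝ × ℝ => Real.sqrt (c / (2 * Real.pi * p.2)) *
      ∫ η : ℝ, Real.exp (-c * (p.1 - η) ^ 2 / (2 * p.2)) * f η) (0, 1) := by
  obtain ⟨B, hB⟩ := hf_bdd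
  refine ContinuousAt.mul ?_ ?_
  · refine Real.continuous_sqrt.continuousAt.comp ?_
    refine continuousAt_const.div (by fun_prop) ?_
    simp [Real.pi_ne_zero]
  · refine continuousAt_of_dominated
      (bound := fun η => Real.exp (-(c / 8) * η ^ 2) * (Real.exp (c / 4) * B))
      ?_ ?_ ?_ ?_
    · refine Filter.Eventually.of_forall fun p => ?_
      exact Continuous.aestronglyMeasurable (by fun_prop)
    · have h1 : ∀ᶠ p : ℝ × ℝ in nhds (0, 1), p.1 ∈ Set.Ioo (-1 : ℝ) 1 :=
        continuousAt_fst.eventually_mem (Ioo_mem_nhds (by norm_num) (by norm_num))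
      have h2 : ∀ᶠ p : ℝ × ℝ in nhds (0, 1), p.2 ∈ Set.Ioo (0 : ℝ) 2 :=
        continuousAt_snd.eventually_mem (Ioo_mem_nhds (by norm_num) (by norm_num))
      filter_upwards [h1, h2] with p ⟨hb1, hb2⟩ ⟨ha1, ha2⟩
      refine Filter.Eventually.of_forall fun η => ?_
      rw [Real.norm_eq_abs, abs_mul, Real.abs_exp, ← mul_assoc, ← Real.exp_add]
      refine mul_le_mul (Real.exp_le_exp.mpr ?_) (hB η) (abs_nonneg _) (Real.exp_nonneg _)
      have hsq : η ^ 2 / 2 - 1 ≤ (p.1 - η) ^ 2 := by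
        nlinarith [sq_nonneg (2 * p.1 - η)]
      have hdiv : c * (p.1 - η) ^ 2 / 4 ≤ c * (p.1 - η) ^ 2 / (2 * p.2) :=
        div_le_div_of_nonneg_left (by positivity) (by positivity) (by linarith)
      have hmul := mul_le_mul_of_nonneg_left hsq hc.le
      rw [neg_mul, neg_div]
      linarith
    · exact (integrable_exp_neg_mul_sq (by positivity)).mul_const _
    · refine Filter.Eventually.of_forall fun η => ?_
      refine ContinuousAt.mul (Real.continuous_exp.continuousAt.comp ?_) continuousAt_const
      exact ContinuousAt.div (by fun_prop) (by fun_prop) (by norm_num)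

/-- Long-time convergence of `e^{τ𝓛₃}f` to the constant
`(χ/(2π))^{1/2} ∫ e^{-χη²/2} f(η) dη`, uniformly on the expanding intervals
`|ξ₃| ≤ e^{(χ-δ)τ}`, for any `δ > 0`. -/
theorem semigL3_longtime_convergence
    (μ : ℝ) (hμ : 1 < μ)
    (f : ℝ → ℝ) (hf_cont : Continuous f) (hf_bdd : ∃ B, ∀ η, |f η| ≤ B)
    (δ : ℝ) (hδ : 0 < δ) :
    ∀ ε : ℝ, 0 < ε → ∃ T : ℝ, ∀ τ : ℝ, T ≤ τ →
      ∀ ξ : ℝ, |ξ| ≤ Real.exp ((χμ μ - δ) * τ) →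
        |semigL3 μ f ξ τ -
            Real.sqrt (χμ μ / (2 * Real.pi)) *
              ∫ η : ℝ, Real.exp (-(χμ μ) * η ^ 2 / 2) * f η| ≤ ε := by
  intro ε hε
  have hχ : 0 < χμ μ := div_pos (by linarith) (by linarith)
  obtain ⟨r, hr, hball⟩ :=
    Metric.continuousAt_iff.mp (continuousAt_gaussian_average hχ hf_cont hf_bdd) ε hε
  have decay : ∀ k : ℝ, 0 < k →
      Filter.Tendsto (fun τ : ℝ => Real.exp (-(k * τ))) Filter.atTop (nhds 0) := fun k hk =>
    Real.tendsto_exp_neg_atTop_nhds_zero.comp (Filter.tendsto_id.const_mul_atTop hk)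
  obtain ⟨T, hT⟩ := Filter.eventually_atTop.mp
    (((decay δ hδ).eventually_lt_const hr).and
      ((decay (2 * χμ μ) (by positivity)).eventually_lt_const hr))
  refine ⟨T, fun τ hτ ξ hξ => ?_⟩
  obtain ⟨hb, ha⟩ := hT τ hτ
  have hshift : |Real.exp (-(χμ μ) * τ) * ξ| ≤ Real.exp (-(δ * τ)) := by
    rw [abs_mul, Real.abs_exp]
    calc _ ≤ Real.exp (-(χμ μ) * τ) * Real.exp ((χμ μ - δ) * τ) := by gcongr
      _ = Real.exp (-(δ * τ)) := by rw [← Real.exp_add]; ring_nf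
  have hdist : dist (Real.exp (-(χμ μ) * τ) * ξ, aFun (2 * χμ μ * τ)) ((0 : ℝ), (1 : ℝ)) < r := by
    rw [Prod.dist_eq, max_lt_iff, Real.dist_eq, Real.dist_eq]
    refine ⟨by simpa using hshift.trans_lt hb, ?_⟩
    simpa [aFun] using ha
  have h := (hball hdist).le
  simpa [semigL3, Real.dist_eq] using h

end
end

section
/- Let f: ℝ² → ℝ be smooth with sup_{ξ'∈ℝ²} e^{|ξ'|²/8} (|f(ξ')| + |∇'f(ξ')|) < ∞. Then ∫_{ℝ²} e^{|ξ'|²/4} (u^G(ξ')·∇'f(ξ')) f(ξ') dξ' = 0; that is, the advection operator f ↦ u^G·∇'f is skew-symmetric with respect to the Gaussian-weighted inner product ⟨f₁,f₂⟩ = ∫_{ℝ²} e^{|ξ'|²/4} f₁ f₂ dξ'. -/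
open MeasureTheory

noncomputable section

/-- The two-dimensional Oseen vortex velocity profile, extended continuously by `0`
at the origin. -/
def uG2 (ξ : Fin 2 → ℝ) : Fin 2 → ℝ :=
  if ξ = 0 then 0 else
    ((1 - Real.exp (-(ξ 0 ^ 2 + ξ 1 ^ 2) / 4)) / (2 * Real.pi * (ξ 0 ^ 2 + ξ 1 ^ 2))) •
      ![-(ξ 1), ξ 0]

theorem uG2_of_polar {r : ℝ} (hr : 0 < r) (θ : ℝ) :
    uG2 ![r * Real.cos θ, r * Real.sin θ] =
      ((1 - Real.exp (-r ^ 2 / 4)) / (2 * Real.pi * r ^ 2)) •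
        ![-(r * Real.sin θ), r * Real.cos θ] := by
  have hsq : (r * Real.cos θ) ^ 2 + (r * Real.sin θ) ^ 2 = r ^ 2 := by
    linear_combination r ^ 2 * Real.sin_sq_add_cos_sq θ
  have hne : ![r * Real.cos θ, r * Real.sin θ] ≠ 0 := by
    intro h
    have h0 := congrFun h 0
    have h1 := congrFun h 1
    simp only [Matrix.cons_val_zero, Matrix.cons_val_one, Pi.zero_apply] at h0 h1
    rw [h0, h1] at hsq
    nlinarith [pow_pos hr 2]
  simp [uG2, hne, hsq]

theorem fderiv_apply_eq_pd2 (f : (Fin 2 → ℝ) → ℝ) (ξ : Fin 2 → ℝ) (a b : ℝ) :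
    fderiv ℝ f ξ ![a, b] = a * pd2 0 f ξ + b * pd2 1 f ξ := by
  have h : ![a, b] = a • (Pi.single 0 1 : Fin 2 → ℝ) + b • (Pi.single 1 1 : Fin 2 → ℝ) := by
    ext i
    fin_cases i <;> simp
  rw [h, map_add, map_smul, map_smul]
  simp [pd2]

theorem hasDerivAt_comp_polar {f : (Fin 2 → ℝ) → ℝ} (hf : Differentiable ℝ f) (r θ : ℝ) :
    HasDerivAt (fun t => f ![r * Real.cos t, r * Real.sin t])
      (-(r * Real.sin θ) * pd2 0 f ![r * Real.cos θ, r * Real.sin θ] +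
        r * Real.cos θ * pd2 1 f ![r * Real.cos θ, r * Real.sin θ]) θ := by
  have hc : HasDerivAt (fun t => ![r * Real.cos t, r * Real.sin t])
      ![-(r * Real.sin θ), r * Real.cos θ] θ := by
    rw [hasDerivAt_pi]
    intro i
    fin_cases i
    · simpa using (Real.hasDerivAt_cos θ).const_mul r
    · simpa using (Real.hasDerivAt_sin θ).const_mul r
  rw [← fderiv_apply_eq_pd2]
  exact (hf _).hasFDerivAt.comp_hasDerivAt θ hc

/-- The angular derivative of a function times the function integrates to `0` over a circle. -/
theorem integral_angular_deriv_mul_self {f : (Fin 2 → ℝ) → ℝ} (hf : ContDiff ℝ 1 f) (r : ℝ) :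
    ∫ θ in Set.Ioo (-Real.pi) Real.pi,
      (-(r * Real.sin θ) * pd2 0 f ![r * Real.cos θ, r * Real.sin θ] +
        r * Real.cos θ * pd2 1 f ![r * Real.cos θ, r * Real.sin θ]) *
        f ![r * Real.cos θ, r * Real.sin θ] = 0 := by
  have hcurve : Continuous fun t : ℝ => ![r * Real.cos t, r * Real.sin t] := by
    fun_prop
  have hpd (i : Fin 2) : Continuous fun t : ℝ => pd2 i f ![r * Real.cos t, r * Real.sin t] :=
    ((hf.continuous_fderiv one_ne_zero).clm_apply continuous_const).comp hcurve
  have hfc : Continuous fun t : ℝ => f ![r * Real.cos t, r * Real.sin t] :=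
    hf.continuous.comp hcurve
  have h0 := hpd 0
  have h1 := hpd 1
  rw [← integral_Ioc_eq_integral_Ioo,
    ← intervalIntegral.integral_of_le (by linarith [Real.pi_pos]),
    intervalIntegral.integral_eq_sub_of_hasDerivAt
      (f := fun t => f ![r * Real.cos t, r * Real.sin t] ^ 2 / 2)]
  · simp
  · intro θ _
    refine (((hasDerivAt_comp_polar (hf.differentiable one_ne_zero) r θ).pow 2).div_const
      2).congr_deriv ?_
    push_cast
    ring
  · exact Continuous.intervalIntegrable (by fun_prop) _ _

/-- Skew-symmetry of the advection operator `f ↦ u^G·∇'f` with respect to the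
Gaussian-weighted inner product: for smooth `f` with Gaussian-weighted decay of `f`
and `∇'f`, `∫ e^{|ξ'|²/4} (u^G·∇'f) f dξ' = 0`. -/
theorem advection_skew_symmetric
    (f : (Fin 2 → ℝ) → ℝ) (hf : ContDiff ℝ (⊤ : ℕ∞) f)
    (hdec : ∃ C : ℝ, ∀ ξ : Fin 2 → ℝ,
      Real.exp ((ξ 0 ^ 2 + ξ 1 ^ 2) / 8) * (|f ξ| + ‖fderiv ℝ f ξ‖) ≤ C) :
    ∫ ξ : Fin 2 → ℝ,
      Real.exp ((ξ 0 ^ 2 + ξ 1 ^ 2) / 4) *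
        (uG2 ξ 0 * pd2 0 f ξ + uG2 ξ 1 * pd2 1 f ξ) * f ξ = 0 := by
  set F : (Fin 2 → ℝ) → ℝ := fun ξ => Real.exp ((ξ 0 ^ 2 + ξ 1 ^ 2) / 4) *
    (uG2 ξ 0 * pd2 0 f ξ + uG2 ξ 1 * pd2 1 f ξ) * f ξ with hF
  have hprod : ∫ ξ, F ξ = ∫ p : ℝ × ℝ, F ![p.1, p.2] :=
    ((volume_preserving_finTwoArrow ℝ).symm.integral_comp'
      (g := F)).symm
  rw [hprod, ← integral_comp_polarCoord_symm]
  by_cases hint : IntegrableOn (fun p : ℝ × ℝ => p.1 •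
      F ![(polarCoord.symm p).1, (polarCoord.symm p).2]) polarCoord.target
  swap
  · exact integral_undef hint
  rw [polarCoord_target] at hint ⊢
  rw [Measure.volume_eq_prod] at hint ⊢
  rw [setIntegral_prod _ hint]
  refine setIntegral_eq_zero_of_forall_eq_zero fun r hr => ?_
  have hsq (θ : ℝ) : (r * Real.cos θ) ^ 2 + (r * Real.sin θ) ^ 2 = r ^ 2 := by
    linear_combination r ^ 2 * Real.sin_sq_add_cos_sq θ
  have hzero := congrArg (r * Real.exp (r ^ 2 / 4) *
      ((1 - Real.exp (-r ^ 2 / 4)) / (2 * Real.pi * r ^ 2)) * ·)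
    (integral_angular_deriv_mul_self (hf.of_le (by exact_mod_cast le_top)) r)
  simp only [mul_zero, ← integral_const_mul] at hzero
  rw [← hzero]
  congr 1
  ext θ
  simp only [hF, polarCoord_symm_apply, uG2_of_polar hr, smul_eq_mul, Pi.smul_apply,
    Matrix.cons_val_zero, Matrix.cons_val_one, hsq]
  ring

end
end

section
/- Let μ > 1, α ∈ ℝ, and χ = (2μ+1)/(2(μ−1)). For a Schwartz vector field w: ℝ³ → ℝ³, define 𝒱 = K_{3D} * w by (K_{3D}*w)(ξ) = −(1/(4π)) ∫_{ℝ³} ((ξ−y) × w(y))/|ξ−y|³ dy, and define (L_μ − αΛ)w = Δw + (ξ'/2)·∇'w − χ ξ₃ ∂₃ w + (1/(μ−1))(μM − I)w − α( U^G·∇w + 𝒱·∇G − w·∇U^G − G·∇𝒱 ), where M = diag(−1/2, −1/2, 1). Then for every ξ ∈ ℝ³ with ξ' ≠ 0, the commutation identity holds: ∂₃((L_μ − αΛ)w)(ξ) = ((L_μ − αΛ)(∂₃w))(ξ) − χ (∂₃w)(ξ), where in (L_μ − αΛ)(∂₃w) the Biot–Savart velocity is K_{3D}*(∂₃w). In other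 words, [∂₃, L_μ − αΛ] = −χ ∂₃. -/
open MeasureTheory

noncomputable section

/-- The Euclidean norm on `ℝ³`. -/
def enorm3 (v : Fin 3 → ℝ) : ℝ := Real.sqrt (∑ i, (v i) ^ 2)

/-- The three-dimensional Biot–Savart law
`(K_{3D}*w)(ξ) = -(1/(4π)) ∫ ((ξ-y) × w(y))/|ξ-y|³ dy`. -/
def biot (w : (Fin 3 → ℝ) → Fin 3 → ℝ) (ξ : Fin 3 → ℝ) : Fin 3 → ℝ :=
  (-(1 / (4 * Real.pi))) •
    ∫ y : Fin 3 → ℝ, (enorm3 (ξ - y) ^ 3)⁻¹ • cross3 (ξ - y) (w y)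

/-- `U^G(ξ')` regarded as a vector field on `ℝ³` depending only on `ξ' = (ξ₁,ξ₂)`. -/
def UG3f (ξ : Fin 3 → ℝ) : Fin 3 → ℝ :=
  ((1 - Real.exp (-(ξ 0 ^ 2 + ξ 1 ^ 2) / 4)) / (2 * Real.pi * (ξ 0 ^ 2 + ξ 1 ^ 2))) •
    ![-(ξ 1), ξ 0, 0]

/-- `G(ξ') = (0, 0, (1/(4π))e^{-|ξ'|²/4})` regarded as a vector field on `ℝ³`. -/
def G3f (ξ : Fin 3 → ℝ) : Fin 3 → ℝ :=
  ![0, 0, (1 / (4 * Real.pi)) * Real.exp (-(ξ 0 ^ 2 + ξ 1 ^ 2) / 4)]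

/-- `M = diag(-1/2, -1/2, 1)`, as the vector of its diagonal entries. -/
def mdiag : Fin 3 → ℝ := ![-(1 / 2), -(1 / 2), 1]

/-- The linearized operator `(L_μ - αΛ)w` around the (scaled) Burgers vortex:
`Δw + (ξ'/2)·∇'w - χξ₃∂₃w + (1/(μ-1))(μM - I)w - α(U^G·∇w + 𝒱·∇G - w·∇U^G - G·∇𝒱)`
where `𝒱 = K_{3D}*w`. -/
def Lop (μ α : ℝ) (w : (Fin 3 → ℝ) → Fin 3 → ℝ) (ξ : Fin 3 → ℝ) : Fin 3 → ℝ :=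
  fun i =>
    (∑ j, pd j (fun y => pd j (fun z => w z i) y) ξ) +
      (ξ 0 / 2) * pd 0 (fun z => w z i) ξ + (ξ 1 / 2) * pd 1 (fun z => w z i) ξ -
      χμ μ * ξ 2 * pd 2 (fun z => w z i) ξ +
      (1 / (μ - 1)) * (μ * mdiag i - 1) * w ξ i -
      α * ((∑ j, UG3f ξ j * pd j (fun z => w z i) ξ) +
            (∑ j, biot w ξ j * pd j (fun z => G3f z i) ξ) -
            (∑ j, w ξ j * pd j (fun z => UG3f z i) ξ) -
            (∑ j, G3f ξ j * pd j (fun z => biot w z i) ξ))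

/-- The vertical derivative `∂₃w` of a vector field, taken componentwise. -/
def d3 (w : (Fin 3 → ℝ) → Fin 3 → ℝ) (ξ : Fin 3 → ℝ) : Fin 3 → ℝ :=
  fun i => pd 2 (fun z => w z i) ξ

section Helpers

open Filter Topology SchwartzMap LineDeriv

local notation "ℝ³" => Fin 3 → ℝ

/-- The Biot–Savart kernel `y ↦ (y × ·) / |y|³` as an operator-valued function. -/
def biotKernel (y : ℝ³) : ℝ³ →L[ℝ] ℝ³ :=
  (enorm3 y ^ 3)⁻¹ • (crossProduct (R := ℝ)).toContinuousBilinearMap y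

theorem biotKernel_apply (y v : ℝ³) :
    biotKernel y v = (enorm3 y ^ 3)⁻¹ • cross3 y v := rfl

theorem measurable_biotKernel : StronglyMeasurable biotKernel := by
  have h : Measurable fun y : ℝ³ => (enorm3 y ^ 3)⁻¹ := by
    unfold enorm3
    fun_prop
  exact h.stronglyMeasurable.smul (ContinuousLinearMap.continuous _).stronglyMeasurable

theorem norm_le_enorm3 (y : ℝ³) : ‖y‖ ≤ enorm3 y := by
  refine (pi_norm_le_iff_of_nonneg (Real.sqrt_nonneg _)).2 fun i => ?_
  rw [Real.norm_eq_abs]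
  exact Real.abs_le_sqrt
    (Finset.single_le_sum (f := fun i => y i ^ 2) (fun j _ => sq_nonneg _) (Finset.mem_univ i))

theorem exists_norm_biotKernel_le : ∃ A, 0 ≤ A ∧ ∀ y, ‖biotKernel y‖ ≤ A * (‖y‖ ^ 2)⁻¹ := by
  refine ⟨‖(crossProduct (R := ℝ)).toContinuousBilinearMap‖,
    ContinuousLinearMap.opNorm_nonneg _, fun y => ?_⟩
  rcases eq_or_ne y 0 with rfl | hy
  · simp [biotKernel]
  have hy' : 0 < ‖y‖ := norm_pos_iff.2 hy
  have h := norm_le_enorm3 y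
  rw [biotKernel, norm_smul, norm_inv, norm_pow,
    Real.norm_of_nonneg (hy'.le.trans h)]
  calc _ ≤ (‖y‖ ^ 3)⁻¹ * (‖(crossProduct (R := ℝ)).toContinuousBilinearMap‖ * ‖y‖) := by
        gcongr
        exact ContinuousLinearMap.le_opNorm _ _
    _ = _ := by field_simp

theorem integrable_inv_sq_mul_inv_one_add_sq :
    Integrable fun y : ℝ³ => (‖y‖ ^ 2)⁻¹ * ((1 + ‖y‖) ^ 2)⁻¹ := by
  refine (integrable_fun_norm_addHaar volume
    (f := fun r : ℝ => (r ^ 2)⁻¹ * ((1 + r) ^ 2)⁻¹)).2 ?_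
  have h := integrableOn_add_rpow_Ioi_of_lt (a := -2) (c := 0) (m := 1) (by norm_num) (by norm_num)
  refine h.congr_fun (fun r hr => ?_) measurableSet_Ioi
  have hr : 0 < r := hr
  simp only [Module.finrank_fin_fun, smul_eq_mul]
  rw [Real.rpow_neg (by positivity), add_comm r 1]
  norm_cast
  field_simp

theorem SchwartzMap.exists_norm_sub_le {F : Type*} [NormedAddCommGroup F] [NormedSpace ℝ F]
    (φ : 𝓢(ℝ³, F)) (x₀ : ℝ³) :
    ∃ C, ∀ x ∈ Metric.ball x₀ 1, ∀ y, ‖φ (x - y)‖ ≤ C * ((1 + ‖y‖) ^ 2)⁻¹ := by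
  set S := 2 ^ (2, 0).1 * ((Finset.Iic (2, 0)).sup fun m => SchwartzMap.seminorm ℝ m.1 m.2) φ
  refine ⟨(2 + ‖x₀‖) ^ 2 * S, fun x hx y => ?_⟩
  have h := one_add_le_sup_seminorm_apply (𝕜 := ℝ) (m := (2, 0)) le_rfl le_rfl φ (x - y)
  rw [norm_iteratedFDeriv_zero] at h
  rw [← div_eq_mul_inv, le_div_iff₀ (by positivity)]
  have h1 : ‖x‖ ≤ ‖x₀‖ + 1 := by
    have := norm_sub_norm_le x x₀
    rw [mem_ball_iff_norm] at hx
    linarith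
  have h2 : 1 + ‖y‖ ≤ (2 + ‖x₀‖) * (1 + ‖x - y‖) := by
    have := norm_sub_norm_le y x
    rw [norm_sub_rev] at this
    nlinarith [norm_nonneg x₀, norm_nonneg (x - y)]
  calc ‖φ (x - y)‖ * (1 + ‖y‖) ^ 2
      ≤ ‖φ (x - y)‖ * ((2 + ‖x₀‖) * (1 + ‖x - y‖)) ^ 2 := by gcongr
    _ = (2 + ‖x₀‖) ^ 2 * ((1 + ‖x - y‖) ^ 2 * ‖φ (x - y)‖) := by ring
    _ ≤ (2 + ‖x₀‖) ^ 2 * S := by gcongr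

theorem biot_eq_integral_biotKernel (w : ℝ³ → ℝ³) (x : ℝ³) :
    biot w x = (-(1 / (4 * Real.pi))) • ∫ y, biotKernel y (w (x - y)) := by
  rw [biot, ← integral_sub_left_eq_self (fun y => biotKernel y (w (x - y))) volume x]
  simp [biotKernel_apply]

theorem SchwartzMap.hasFDerivAt_integral_biotKernel (w : 𝓢(ℝ³, ℝ³)) (x : ℝ³) :
    Integrable (fun y => (biotKernel y).comp (fderiv ℝ w (x - y))) ∧
    HasFDerivAt (fun x => ∫ y, biotKernel y (w (x - y)))
      (∫ y, (biotKernel y).comp (fderiv ℝ w (x - y))) x := by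
  obtain ⟨A, hA, hK⟩ := exists_norm_biotKernel_le
  obtain ⟨C₀, hC₀⟩ := exists_norm_sub_le w x
  obtain ⟨C₁, hC₁⟩ := exists_norm_sub_le (fderivCLM ℝ ℝ³ ℝ³ w) x
  simp only [fderivCLM_apply] at hC₁
  have hmeas (z : ℝ³) : AEStronglyMeasurable (fun y => biotKernel y (w (z - y))) volume :=
    (isBoundedBilinearMap_apply.continuous.comp_stronglyMeasurable
      (measurable_biotKernel.prodMk
        (w.continuous.comp (continuous_sub_left z)).stronglyMeasurable)).aestronglyMeasurable
  have hcont : Continuous (fderiv ℝ w) := (fderivCLM ℝ ℝ³ ℝ³ w).continuous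
  have hmeas' : AEStronglyMeasurable
      (fun y => (biotKernel y).comp (fderiv ℝ w (x - y))) volume :=
    (isBoundedBilinearMap_comp.continuous.comp_stronglyMeasurable
      (measurable_biotKernel.prodMk
        (hcont.comp (continuous_sub_left x)).stronglyMeasurable)).aestronglyMeasurable
  have hbound : ∀ y, ∀ z ∈ Metric.ball x 1, ‖(biotKernel y).comp (fderiv ℝ w (z - y))‖ ≤
      (A * C₁) * ((‖y‖ ^ 2)⁻¹ * ((1 + ‖y‖) ^ 2)⁻¹) := fun y z hz =>
    calc _ ≤ ‖biotKernel y‖ * ‖fderiv ℝ w (z - y)‖ := ContinuousLinearMap.opNorm_comp_le _ _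
      _ ≤ (A * (‖y‖ ^ 2)⁻¹) * (C₁ * ((1 + ‖y‖) ^ 2)⁻¹) := by
        gcongr
        exacts [hK y, hC₁ z hz y]
      _ = _ := by ring
  have hint := integrable_inv_sq_mul_inv_one_add_sq
  have hx : x ∈ Metric.ball x 1 := Metric.mem_ball_self one_pos
  refine ⟨(hint.const_mul (A * C₁)).mono' hmeas' (.of_forall fun y => hbound y x hx),
    hasFDerivAt_integral_of_dominated_of_fderiv_le (Metric.ball_mem_nhds x one_pos)
      (.of_forall hmeas) ?_ hmeas' (.of_forall hbound) (hint.const_mul (A * C₁))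
      (.of_forall fun y z _ => ?_)⟩
  · refine (hint.const_mul (A * C₀)).mono' (hmeas x) (.of_forall fun y => ?_)
    calc _ ≤ ‖biotKernel y‖ * ‖w (x - y)‖ := ContinuousLinearMap.le_opNorm _ _
      _ ≤ (A * (‖y‖ ^ 2)⁻¹) * (C₀ * ((1 + ‖y‖) ^ 2)⁻¹) := by
        gcongr
        exacts [hK y, hC₀ x hx y]
      _ = _ := by ring
  · have h : HasFDerivAt (fun z => w (z - y)) (fderiv ℝ w (z - y)) z :=
      (hasFDerivAt_comp_sub y).2 (w.differentiableAt).hasFDerivAt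
    exact (biotKernel y).hasFDerivAt.comp z h

theorem SchwartzMap.differentiable_biot (w : 𝓢(ℝ³, ℝ³)) : Differentiable ℝ (biot w) := by
  rw [funext (biot_eq_integral_biotKernel w)]
  exact fun x => (w.hasFDerivAt_integral_biotKernel x).2.differentiableAt.fun_const_smul _

theorem SchwartzMap.fderiv_biot (w : 𝓢(ℝ³, ℝ³)) (x v : ℝ³) :
    fderiv ℝ (biot w) x v = biot (∂_{v} w : 𝓢(ℝ³, ℝ³)) x := by
  obtain ⟨hint, h⟩ := w.hasFDerivAt_integral_biotKernel x
  rw [funext (biot_eq_integral_biotKernel w), biot_eq_integral_biotKernel,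
    (h.fun_const_smul _).fderiv, smul_apply,
    ContinuousLinearMap.integral_apply hint]
  simp [lineDerivOp_apply_eq_fderiv]

/-- The partial derivative of a Schwartz vector field in the `j`-th coordinate direction. -/
def SchwartzMap.pderiv (j : Fin 3) (w : 𝓢(ℝ³, ℝ³)) : 𝓢(ℝ³, ℝ³) :=
  ∂_{(Pi.single j 1 : ℝ³)} w

theorem pd_apply {f : ℝ³ → ℝ³} {x : ℝ³} (hf : DifferentiableAt ℝ f x) (i j : Fin 3) :
    pd j (fun z => f z i) x = fderiv ℝ f x (Pi.single j 1) i := by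
  rw [pd, fderiv_apply hf]
  rfl

theorem SchwartzMap.pd_apply (w : 𝓢(ℝ³, ℝ³)) (i j : Fin 3) :
    pd j (fun z => w z i) = fun z => (w.pderiv j) z i := by
  ext x
  rw [_root_.pd_apply w.differentiableAt, pderiv, lineDerivOp_apply_eq_fderiv]

theorem SchwartzMap.pd_biot (w : 𝓢(ℝ³, ℝ³)) (i j : Fin 3) :
    pd j (fun z => biot w z i) = fun z => biot (w.pderiv j) z i := by
  ext x
  rw [_root_.pd_apply w.differentiable_biot.differentiableAt, fderiv_biot, pderiv]

theorem SchwartzMap.d3_eq (w : 𝓢(ℝ³, ℝ³)) : d3 w = w.pderiv 2 := by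
  ext x i
  rw [d3, w.pd_apply]

theorem SchwartzMap.pderiv_comm (i j : Fin 3) (w : 𝓢(ℝ³, ℝ³)) :
    (w.pderiv i).pderiv j = (w.pderiv j).pderiv i := by
  ext1 x
  have key (a b : ℝ³) : (∂_{a} (∂_{b} w) : 𝓢(ℝ³, ℝ³)) x = fderiv ℝ (fderiv ℝ w) x a b := by
    rw [lineDerivOp_apply_eq_fderiv,
      show ⇑(∂_{b} w : 𝓢(ℝ³, ℝ³)) = fun z => fderiv ℝ w z b from
        funext fun z => lineDerivOp_apply_eq_fderiv b w z,
      fderiv_clm_apply (c := fderiv ℝ w) (fderivCLM ℝ ℝ³ ℝ³ w).differentiableAt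
        (differentiableAt_const b)]
    simp
  rw [pderiv, pderiv, key, pderiv, pderiv, key]
  exact ((w.smooth 2).contDiffAt.isSymmSndFDerivAt (by simp)).eq _ _

/-- `f` is differentiable at `x` with vertical derivative `f'`. -/
def HasVertDerivAt (f : ℝ³ → ℝ) (f' : ℝ) (x : ℝ³) : Prop :=
  DifferentiableAt ℝ f x ∧ pd 2 f x = f'

namespace HasVertDerivAt

variable {f g : ℝ³ → ℝ} {f' g' : ℝ} {x : ℝ³}

theorem add (hf : HasVertDerivAt f f' x) (hg : HasVertDerivAt g g' x) :
    HasVertDerivAt (fun z => f z + g z) (f' + g') x :=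
  ⟨hf.1.add hg.1, by simp [pd, fderiv_fun_add hf.1 hg.1, ← hf.2, ← hg.2]⟩

theorem sub (hf : HasVertDerivAt f f' x) (hg : HasVertDerivAt g g' x) :
    HasVertDerivAt (fun z => f z - g z) (f' - g') x :=
  ⟨hf.1.sub hg.1, by simp [pd, fderiv_fun_sub hf.1 hg.1, ← hf.2, ← hg.2]⟩

theorem mul (hf : HasVertDerivAt f f' x) (hg : HasVertDerivAt g g' x) :
    HasVertDerivAt (fun z => f z * g z) (f x * g' + g x * f') x :=
  ⟨hf.1.mul hg.1, by simp [pd, fderiv_fun_mul hf.1 hg.1, ← hf.2, ← hg.2]⟩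

theorem const_mul (c : ℝ) (hf : HasVertDerivAt f f' x) :
    HasVertDerivAt (fun z => c * f z) (c * f') x :=
  ⟨hf.1.const_mul c, by simp [pd, fderiv_const_mul hf.1, ← hf.2]⟩

theorem div_const (c : ℝ) (hf : HasVertDerivAt f f' x) :
    HasVertDerivAt (fun z => f z / c) (f' / c) x := by
  simpa only [div_eq_inv_mul] using hf.const_mul c⁻¹

theorem sum {f : Fin 3 → ℝ³ → ℝ} {f' : Fin 3 → ℝ} (h : ∀ j, HasVertDerivAt (f j) (f' j) x) :
    HasVertDerivAt (fun z => ∑ j, f j z) (∑ j, f' j) x := by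
  simp only [Fin.sum_univ_three]
  exact ((h 0).add (h 1)).add (h 2)

theorem coord (i : Fin 3) : HasVertDerivAt (fun z => z i) ((Pi.single 2 1 : ℝ³) i) x :=
  ⟨differentiableAt_apply i x, by simp [pd, (hasFDerivAt_apply (𝕜 := ℝ) i x).fderiv]⟩

end HasVertDerivAt

theorem SchwartzMap.hasVertDerivAt (w : 𝓢(ℝ³, ℝ³)) (i : Fin 3) (x : ℝ³) :
    HasVertDerivAt (fun z => w z i) ((w.pderiv 2) x i) x :=
  ⟨differentiableAt_pi.1 w.differentiableAt i, congrFun (w.pd_apply i 2) x⟩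

theorem SchwartzMap.hasVertDerivAt_biot (w : 𝓢(ℝ³, ℝ³)) (i : Fin 3) (x : ℝ³) :
    HasVertDerivAt (fun z => biot w z i) (biot (w.pderiv 2) x i) x :=
  ⟨differentiableAt_pi.1 w.differentiable_biot.differentiableAt i, congrFun (w.pd_biot i 2) x⟩

/-- A differentiable function of the horizontal variables has vanishing vertical derivative. -/
theorem hasVertDerivAt_zero {f : ℝ³ → ℝ} {x : ℝ³} (hf : DifferentiableAt ℝ f x)
    (h : ∀ (z : ℝ³) (t : ℝ), f (z + t • Pi.single 2 1) = f z) : HasVertDerivAt f 0 x := by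
  refine ⟨hf, ?_⟩
  rw [pd, ← hf.lineDeriv_eq_fderiv]
  simp [lineDeriv, h]

theorem hasVertDerivAt_pd_zero {f : ℝ³ → ℝ} {x : ℝ³} (hf : ContDiffAt ℝ 2 f x)
    (h : ∀ (z : ℝ³) (t : ℝ), f (z + t • Pi.single 2 1) = f z) (j : Fin 3) :
    HasVertDerivAt (pd j f) 0 x := by
  refine hasVertDerivAt_zero ?_ fun z t => ?_
  · exact ((hf.fderiv_right (m := 1) (by norm_num)).differentiableAt one_ne_zero).clm_apply
      (differentiableAt_const _)
  · rw [pd, pd, ← fderiv_comp_add_right, funext fun y => h y t]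

theorem contDiffAt_UG3f {x : ℝ³} (hx : ¬(x 0 = 0 ∧ x 1 = 0)) : ContDiffAt ℝ 2 UG3f x := by
  have h0 : x 0 ^ 2 + x 1 ^ 2 ≠ 0 := fun h =>
    hx ⟨by nlinarith [sq_nonneg (x 0), sq_nonneg (x 1)],
      by nlinarith [sq_nonneg (x 0), sq_nonneg (x 1)]⟩
  have h1 : 2 * Real.pi * (x 0 ^ 2 + x 1 ^ 2) ≠ 0 := by positivity
  unfold UG3f
  refine ContDiffAt.smul (𝕜 := ℝ) (𝕜' := ℝ)
    (ContDiffAt.div (n := 2) (by fun_prop) (by fun_prop) h1) ?_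
  rw [contDiffAt_pi]
  intro i
  fin_cases i <;> simp <;> fun_prop

theorem contDiff_G3f : ContDiff ℝ 2 G3f := by
  unfold G3f
  rw [contDiff_pi]
  intro i
  fin_cases i <;> simp <;> fun_prop

theorem UG3f_add_vertical (z : ℝ³) (t : ℝ) : UG3f (z + t • Pi.single 2 1) = UG3f z := by
  simp [UG3f]

theorem G3f_add_vertical (z : ℝ³) (t : ℝ) : G3f (z + t • Pi.single 2 1) = G3f z := by
  simp [G3f]

end Helpers

/-- The commutation identity `[∂₃, L_μ - αΛ] = -χ∂₃`: for a Schwartz vector field `w`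
and every `ξ` with `ξ' ≠ 0`,
`∂₃((L_μ - αΛ)w) = (L_μ - αΛ)(∂₃w) - χ ∂₃w`, where in `(L_μ - αΛ)(∂₃w)` the
Biot–Savart velocity is `K_{3D}*(∂₃w)`. -/
theorem commutation_identity
    (μ α : ℝ) (hμ : 1 < μ)
    (w : SchwartzMap (Fin 3 → ℝ) (Fin 3 → ℝ))
    (ξ : Fin 3 → ℝ) (hξ : ¬(ξ 0 = 0 ∧ ξ 1 = 0)) (i : Fin 3) :
    pd 2 (fun z => Lop μ α (⇑w) z i) ξ =
      Lop μ α (d3 (⇑w)) ξ i - χμ μ * d3 (⇑w) ξ i := by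
  have hUc (j : Fin 3) : ContDiffAt ℝ 2 (fun z => UG3f z j) ξ :=
    contDiffAt_pi.1 (contDiffAt_UG3f hξ) j
  have hGc (j : Fin 3) : ContDiffAt ℝ 2 (fun z => G3f z j) ξ :=
    contDiffAt_pi.1 contDiff_G3f.contDiffAt j
  have hUi (j : Fin 3) (z : Fin 3 → ℝ) (t : ℝ) :
      UG3f (z + t • Pi.single 2 1) j = UG3f z j := by rw [UG3f_add_vertical]
  have hGi (j : Fin 3) (z : Fin 3 → ℝ) (t : ℝ) :
      G3f (z + t • Pi.single 2 1) j = G3f z j := by rw [G3f_add_vertical]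
  have hU (j : Fin 3) := hasVertDerivAt_zero ((hUc j).differentiableAt two_ne_zero) (hUi j)
  have hG (j : Fin 3) := hasVertDerivAt_zero ((hGc j).differentiableAt two_ne_zero) (hGi j)
  have hdU (j k : Fin 3) := hasVertDerivAt_pd_zero (hUc k) (hUi k) j
  have hdG (j k : Fin 3) := hasVertDerivAt_pd_zero (hGc k) (hGi k) j
  unfold Lop
  simp only [SchwartzMap.d3_eq, SchwartzMap.pd_apply, SchwartzMap.pd_biot]
  have hx (j : Fin 3) := HasVertDerivAt.coord (x := ξ) j
  have key := (((((HasVertDerivAt.sum fun j =>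
    ((w.pderiv j).pderiv j).hasVertDerivAt i ξ).add
    (((hx 0).div_const 2).mul
      ((w.pderiv 0).hasVertDerivAt i ξ))).add
    (((hx 1).div_const 2).mul
      ((w.pderiv 1).hasVertDerivAt i ξ))).sub
    (((hx 2).const_mul (χμ μ)).mul
      ((w.pderiv 2).hasVertDerivAt i ξ))).add
    ((w.hasVertDerivAt i ξ).const_mul (1 / (μ - 1) * (μ * mdiag i - 1)))).sub
    (((((HasVertDerivAt.sum fun j => (hU j).mul
        ((w.pderiv j).hasVertDerivAt i ξ)).add
      (HasVertDerivAt.sum fun j => (w.hasVertDerivAt_biot j ξ).mul (hdG j i))).sub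
      (HasVertDerivAt.sum fun j => (w.hasVertDerivAt j ξ).mul (hdU j i))).sub
      (HasVertDerivAt.sum fun j => (hG j).mul
        ((w.pderiv j).hasVertDerivAt_biot i ξ))).const_mul
      α)
  refine key.2.trans ?_
  simp only [Fin.sum_univ_three, SchwartzMap.pderiv_comm 0 2, SchwartzMap.pderiv_comm 1 2]
  simp
  ring

end
end
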